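/- arXiv:1708.09821 — 3 statements merged into one kernel-verified Lean document; each statement's English description precedes it below -/
import Mathlib

section
/- Let Γ be a countably infinite group and let α be a free continuous action of Γ on a nonempty Polish space X which is NOT generically smooth. Let 𝒫 denote the Polish space of all subsets of the (countable) set of finite partial colorings of Γ, with the product (Cantor) topology, and code each subshift Ω by Fin(Ω) ∈ 𝒫. Then the set {Fin(Ω) : Ω is a subshift and α admits a Baire measurable Ω-coloring} is complete analytic: it is an analytic subset of 𝒫, and for every Polish space Z and every analytic set B ⊆ Z there exists a Borel map g : Z → 𝒫 such that g(z) ∈ {Fin(Ω) : Ω is a subshift} for all z ∈ Z, and z ∈ B if and only if g(z) ∈ {Fin(Ω) : Ω is a subshift and α admits a Baire measurable Ω-coloring}. -/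
open Set Function Topology

namespace DescColor

/-- A set is *Baire measurable* if it differs from an open set by a meager set. -/
def BaireMSet {X : Type*} [TopologicalSpace X] (S : Set X) : Prop :=
  ∃ U : Set X, IsOpen U ∧ IsMeagre (symmDiff S U)

/-- A function is *Baire measurable* if preimages of measurable (Borel) sets are
Baire measurable. -/
def BaireMFun {X Y : Type*} [TopologicalSpace X] [MeasurableSpace Y] (f : X → Y) : Prop :=
  ∀ B : Set Y, MeasurableSet B → BaireMSet (f ⁻¹' B)

variable {Γ : Type*}

/-- The shift action of `Γ` on colorings `Γ → ℕ`: `(γ · ω)(δ) = ω (δ γ)`. -/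
def shift [Group Γ] (γ : Γ) (ω : Γ → ℕ) : Γ → ℕ := fun δ => ω (δ * γ)

/-- A subshift: a closed shift-invariant set of colorings. -/
def IsSubshift [Group Γ] (Ω : Set (Γ → ℕ)) : Prop :=
  IsClosed Ω ∧ ∀ (γ : Γ), ∀ ω ∈ Ω, shift γ ω ∈ Ω

/-- The coding map `π_f(x)(γ) = f (γ • x)`. -/
def codingMap [Group Γ] {X : Type*} [MulAction Γ X] (f : X → ℕ) (x : X) : Γ → ℕ :=
  fun γ => f (γ • x)

/-- The action of `Γ` on `X` admits a Baire measurable `Ω`-coloring. -/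
def HasBMColoring [Group Γ] (X : Type*) [TopologicalSpace X] [MulAction Γ X]
    (Ω : Set (Γ → ℕ)) : Prop :=
  ∃ f : X → ℕ, BaireMFun f ∧ {x : X | codingMap f x ∈ Ω} ∈ residual X

/-- The action of `Γ` on `X` is generically smooth. -/
def GenSmooth (Γ : Type*) [Group Γ] (X : Type*) [TopologicalSpace X] [MulAction Γ X] : Prop :=
  ∃ f : X → ℝ, BaireMFun f ∧ ∀ x y : X, f x = f y ↔ ∃ γ : Γ, γ • x = y

/-- The shift action of `Γ` on `ℕ^Γ` admits a Baire measurable `Ω`-coloring. -/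
def ShiftHasBMColoring (Γ : Type*) [Group Γ] (Ω : Set (Γ → ℕ)) : Prop :=
  ∃ f : (Γ → ℕ) → ℕ, BaireMFun f ∧
    {ω : Γ → ℕ | (fun γ : Γ => f (shift γ ω)) ∈ Ω} ∈ residual (Γ → ℕ)

/-- A free continuous action of `Γ` on a Polish space. -/
structure FreePolishAction (Γ : Type*) [Group Γ] where
  X : Type
  ts : TopologicalSpace X
  polish : @PolishSpace X ts
  smul : Γ → X → X
  one_smul' : ∀ x, smul 1 x = x
  mul_smul' : ∀ γ δ x, smul (γ * δ) x = smul γ (smul δ x)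
  cont : ∀ γ : Γ, @Continuous X X ts ts (smul γ)
  free : ∀ (γ : Γ) (x : X), smul γ x = x → γ = 1

/-- A free continuous action on a Polish space admits a Baire measurable `Ω`-coloring. -/
def FreePolishAction.HasBMCol [Group Γ] (α : FreePolishAction Γ) (Ω : Set (Γ → ℕ)) : Prop :=
  letI := α.ts
  ∃ f : α.X → ℕ, BaireMFun f ∧ {x : α.X | (fun γ : Γ => f (α.smul γ x)) ∈ Ω} ∈ residual α.X

/-- A free continuous action on a Polish space is generically smooth. -/
def FreePolishAction.IsGenSmooth [Group Γ] (α : FreePolishAction Γ) : Prop :=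
  letI := α.ts
  ∃ f : α.X → ℝ, BaireMFun f ∧ ∀ x y : α.X, f x = f y ↔ ∃ γ : Γ, α.smul γ x = y

/-- A subshift is *hard* if every free continuous action of `Γ` on a Polish space that
admits a Baire measurable `Ω`-coloring is generically smooth. -/
def Hard (Γ : Type*) [Group Γ] (Ω : Set (Γ → ℕ)) : Prop :=
  ∀ α : FreePolishAction Γ, α.HasBMCol Ω → α.IsGenSmooth

/-- A subshift is *easy* if every free continuous action of `Γ` on a Polish space
admits a Baire measurable `Ω`-coloring. -/
def Easy (Γ : Type*) [Group Γ] (Ω : Set (Γ → ℕ)) : Prop :=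
  ∀ α : FreePolishAction Γ, α.HasBMCol Ω

/-- Finite partial colorings of `Γ`: partial maps `Γ ⇀ ℕ` with finite domain. -/
abbrev FPC (Γ : Type*) : Type _ := {φ : Γ → Option ℕ // {γ : Γ | φ γ ≠ none}.Finite}

/-- The domain of a finite partial coloring. -/
def domP (φ : FPC Γ) : Set Γ := {γ : Γ | φ.1 γ ≠ none}

/-- `Fin(Ω)`: the set of finite partial colorings extending to an element of `Ω`. -/
def FinOf (Ω : Set (Γ → ℕ)) : Set (FPC Γ) :=
  {φ | ∃ ω ∈ Ω, ∀ (γ : Γ) (c : ℕ), φ.1 γ = some c → ω γ = c}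

/-- `g : FPC Γ → Bool` codes (the set `Fin(Ω)` of) the subshift `Ω`. -/
def CodesSubshift [Group Γ] (g : FPC Γ → Bool) (Ω : Set (Γ → ℕ)) : Prop :=
  IsSubshift Ω ∧ ∀ φ : FPC Γ, g φ = true ↔ φ ∈ FinOf Ω

/-- The shift action of `Γ` on finite partial colorings: `(γ · φ)(δ) = φ(δγ)`. -/
def shiftP [Group Γ] (γ : Γ) (φ : FPC Γ) : FPC Γ :=
  ⟨fun δ => φ.1 (δ * γ), by
    apply (φ.2.image fun δ => δ * γ⁻¹).subset
    intro δ hδ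
    exact ⟨δ * γ, hδ, by simp⟩⟩

/-- The empty partial coloring. -/
def emptyP (Γ : Type*) : FPC Γ := ⟨fun _ => none, by simp⟩

/-- The union (join) of two partial colorings (values of `φ` take precedence). -/
def joinP (φ ψ : FPC Γ) : FPC Γ :=
  ⟨fun δ => match φ.1 δ with | some c => some c | none => ψ.1 δ, by
    apply (φ.2.union ψ.2).subset
    intro δ hδ
    by_cases h : φ.1 δ = none
    · right
      simp only [mem_setOf_eq, h] at hδ
      exact hδ
    · exact Or.inl h⟩

/-- The union of a finite list of partial colorings. -/
def joinList (l : List (FPC Γ)) : FPC Γ := l.foldr joinP (emptyP Γ)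

/-- `φ[γ, r]`: the restriction of `φ` to the closed ball `B(γ, r)`. -/
noncomputable def restrictBall [MetricSpace Γ] (φ : FPC Γ) (γ : Γ) (r : ℝ) : FPC Γ :=
  ⟨fun δ => if dist γ δ ≤ r then φ.1 δ else none, by
    apply φ.2.subset
    intro δ hδ
    by_cases h : dist γ δ ≤ r
    · simp only [mem_setOf_eq, if_pos h] at hδ
      exact hδ
    · simp only [mem_setOf_eq, if_neg h] at hδ
      exact absurd rfl hδ⟩

/-- `φ ∪ {(γ, c)}`. -/
def insertP [DecidableEq Γ] (φ : FPC Γ) (γ : Γ) (c : ℕ) : FPC Γ :=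
  ⟨fun δ => if δ = γ then some c else φ.1 δ, by
    apply (φ.2.insert γ).subset
    intro δ hδ
    by_cases h : δ = γ
    · exact Or.inl h
    · right
      simp only [mem_setOf_eq, if_neg h] at hδ
      exact hδ⟩

/-- The restriction of a total coloring `ω` to a finite set `S`. -/
def restrictTo [DecidableEq Γ] (ω : Γ → ℕ) (S : Finset Γ) : FPC Γ :=
  ⟨fun δ => if δ ∈ S then some (ω δ) else none, by
    apply S.finite_toSet.subset
    intro δ hδ
    by_cases h : δ ∈ S
    · exact h
    · simp only [mem_setOf_eq, if_neg h] at hδ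
      exact absurd rfl hδ⟩

/-- Post-composition of a partial coloring with `ρ : ℕ → ℕ`. -/
def mapP (ρ : ℕ → ℕ) (φ : FPC Γ) : FPC Γ :=
  ⟨fun δ => (φ.1 δ).map ρ, by
    apply φ.2.subset
    intro δ hδ
    intro h
    simp only [mem_setOf_eq, h] at hδ
    exact hδ rfl⟩

/-- `ψ` is a restriction of `φ`. -/
def IsRestrictionOf (ψ φ : FPC Γ) : Prop := ∀ δ : Γ, ψ.1 δ = none ∨ ψ.1 δ = φ.1 δ

/-- A `Γ`-ideal: a shift-invariant set of finite partial colorings closed under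
restrictions. -/
def IsGammaIdeal [Group Γ] (P : Set (FPC Γ)) : Prop :=
  (∀ (γ : Γ), ∀ φ ∈ P, shiftP γ φ ∈ P) ∧
  (∀ φ ∈ P, ∀ ψ : FPC Γ, IsRestrictionOf ψ φ → ψ ∈ P)

/-- An extendable `Γ`-ideal. -/
def IsExtendable [DecidableEq Γ] (P : Set (FPC Γ)) : Prop :=
  ∀ φ ∈ P, ∀ γ : Γ, φ.1 γ = none → ∃ c : ℕ, insertP φ γ c ∈ P

/-- `φ` and `ψ` are `R`-separated: `dist(dom φ, dom ψ) > R φ + R ψ`. -/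
def RSeparated [MetricSpace Γ] (R : FPC Γ → ℝ) (φ ψ : FPC Γ) : Prop :=
  ∀ γ ∈ domP φ, ∀ δ ∈ domP ψ, R φ + R ψ < dist γ δ

/-- The join property of a `Γ`-ideal `P`. -/
def HasJoinProperty [Group Γ] [MetricSpace Γ] (P : Set (FPC Γ)) : Prop :=
  ∃ R : FPC Γ → ℝ, (∀ φ, 0 ≤ R φ) ∧ (∀ (γ : Γ), ∀ φ ∈ P, R (shiftP γ φ) = R φ) ∧
    ∀ l : List (FPC Γ), (∀ φ ∈ l, φ ∈ P) → l.Pairwise (RSeparated R) → joinList l ∈ P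

/-- `P^loc_r`: partial colorings that are `r`-locally in `P`. -/
def LocallyIn [MetricSpace Γ] (P : Set (FPC Γ)) (r : ℕ → ℝ) : Set (FPC Γ) :=
  {φ | ∀ (γ : Γ) (c : ℕ), φ.1 γ = some c → restrictBall φ γ (r c) ∈ P}

/-- A local `Γ`-ideal. -/
def IsLocal [MetricSpace Γ] (P : Set (FPC Γ)) : Prop :=
  ∃ r : ℕ → ℝ, (∀ c, 0 ≤ r c) ∧ P = LocallyIn P r

/-- `Col(P)`: colorings all of whose finite restrictions lie in `P`. -/
def ColOf [DecidableEq Γ] (P : Set (FPC Γ)) : Set (Γ → ℕ) :=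
  {ω | ∀ S : Finset Γ, restrictTo ω S ∈ P}

/-! ### The space of Baire measurable functions -/

/-- Baire measurable functions from `X` to `Y`. -/
abbrev BMFunSub (X Y : Type*) [TopologicalSpace X] [MeasurableSpace Y] :=
  {f : X → Y // BaireMFun f}

/-- Equality on a comeager set. -/
def BFunRel {X Y : Type*} [TopologicalSpace X] [MeasurableSpace Y]
    (f g : BMFunSub X Y) : Prop := {x : X | f.1 x = g.1 x} ∈ residual X

/-- `B(X,Y)`: Baire measurable functions modulo equality on a comeager set. -/
abbrev BFun (X Y : Type*) [TopologicalSpace X] [MeasurableSpace Y] :=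
  Quot (BFunRel (X := X) (Y := Y))

/-- `[U, A]`: the classes of functions `f` with `U ∖ f⁻¹(A)` meager. -/
def forceSet {X Y : Type*} [TopologicalSpace X] [MeasurableSpace Y]
    (U : Set X) (A : Set Y) : Set (BFun X Y) :=
  {F | ∃ f : BMFunSub X Y, Quot.mk BFunRel f = F ∧ IsMeagre (U \ f.1 ⁻¹' A)}

/-- `Σ(X,Y)`: the σ-algebra generated by the sets `[U, A]` for `U` nonempty open
and `A` Borel. -/
def SigmaXY (X Y : Type*) [TopologicalSpace X] [MeasurableSpace Y] :
    MeasurableSpace (BFun X Y) :=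
  MeasurableSpace.generateFrom
    {S | ∃ (U : Set X) (A : Set Y), IsOpen U ∧ U.Nonempty ∧ MeasurableSet A ∧ S = forceSet U A}

lemma baireMSet_iff {X : Type*} [TopologicalSpace X] {S : Set X} :
    BaireMSet S ↔ BaireMeasurableSet S := by
  have key : ∀ U : Set X, IsMeagre (symmDiff S U) ↔ S =ᶠ[residual X] U := by
    intro U
    rw [IsMeagre, Filter.eventuallyEq_set, Filter.Eventually]
    have h : (symmDiff S U)ᶜ = {x | x ∈ S ↔ x ∈ U} := by
      ext x
      simp only [mem_compl_iff, mem_symmDiff, mem_ofPred_eq]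
      tauto
    rw [h]
  rw [BaireMeasurableSet.iff_residualEq_isOpen]
  exact exists_congr fun U => and_congr_right fun _ => key U

/-- `ω` extends the finite partial coloring `φ`. -/
def Extends (ω : Γ → ℕ) (φ : FPC Γ) : Prop := ∀ (γ : Γ) (c : ℕ), φ.1 γ = some c → ω γ = c

lemma extends_restrictTo [DecidableEq Γ] {ω ω' : Γ → ℕ} {S : Finset Γ} :
    Extends ω' (restrictTo ω S) ↔ ∀ γ ∈ S, ω' γ = ω γ := by
  simp only [Extends, restrictTo]
  constructor
  · intro h γ hγ
    exact h γ _ (by simp [hγ])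
  · intro h γ c hc
    by_cases hγ : γ ∈ S
    · simp only [hγ, if_true, Option.some.injEq] at hc
      rw [h γ hγ, hc]
    · simp [hγ] at hc

lemma isOpen_extends (φ : FPC Γ) : IsOpen {ω : Γ → ℕ | Extends ω φ} := by
  have h : {ω : Γ → ℕ | Extends ω φ} =
      ⋂ γ ∈ {γ : Γ | φ.1 γ ≠ none}, {ω : Γ → ℕ | φ.1 γ = some (ω γ)} := by
    ext ω
    simp only [Extends, mem_ofPred_eq, mem_iInter]
    constructor
    · intro h γ hγ
      obtain ⟨c, hc⟩ := Option.ne_none_iff_exists'.1 hγ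
      rw [hc, h γ c hc]
    · intro h γ c hc
      have := h γ (by simp [hc])
      rw [hc] at this
      exact (Option.some.inj this).symm
  rw [h]
  refine φ.2.isOpen_biInter fun γ _ => ?_
  exact (isOpen_discrete {c : ℕ | φ.1 γ = some c}).preimage
    (continuous_apply (A := fun _ : Γ => ℕ) γ)

lemma mem_of_isClosed {Ω : Set (Γ → ℕ)} (hΩ : IsClosed Ω) {ω : Γ → ℕ}
    (h : ∀ φ : FPC Γ, Extends ω φ → φ ∈ FinOf Ω) : ω ∈ Ω := by
  classical
  rw [← hΩ.closure_eq, mem_closure_iff]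
  intro o ho hω
  obtain ⟨I, u, hu, hsub⟩ := isOpen_pi_iff.1 ho ω hω
  obtain ⟨ω', hω', hext⟩ := h (restrictTo ω I) (extends_restrictTo.2 fun _ _ => rfl)
  refine ⟨ω', hsub fun γ hγ => ?_, hω'⟩
  rw [extends_restrictTo.1 hext γ hγ]
  exact (hu γ hγ).2

instance instCountableFPC [Countable Γ] : Countable (FPC Γ) := by
  classical
  have hfin : ∀ φ : FPC Γ, {p : Γ × ℕ | φ.1 p.1 = some p.2}.Finite := by
    intro φ
    refine (φ.2.image fun γ => (γ, (φ.1 γ).getD 0)).subset ?_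
    rintro ⟨γ, c⟩ h
    simp only [mem_ofPred_eq] at h
    exact ⟨γ, by simp [h], by simp [h]⟩
  refine Function.Injective.countable (f := fun φ : FPC Γ => (hfin φ).toFinset) ?_
  intro φ ψ h
  have h' : ∀ γ c, φ.1 γ = some c ↔ ψ.1 γ = some c := by
    intro γ c
    have := Finset.ext_iff.1 h (γ, c)
    simpa using this
  refine Subtype.ext (funext fun γ => Option.ext fun c => ?_)
  simpa using h' γ c

/-- The subshift of all colorings whose finite restrictions are accepted by `g`. -/
def colorings (g : FPC Γ → Bool) : Set (Γ → ℕ) :=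
  {ω | ∀ ψ : FPC Γ, Extends ω ψ → g ψ = true}

lemma isClosed_colorings (g : FPC Γ → Bool) : IsClosed (colorings g) := by
  simp only [colorings, ofPred_forall]
  refine isClosed_iInter fun ψ => ?_
  by_cases h : g ψ = true
  · simp [h]
  · simpa [h, compl_ofPred] using (isOpen_extends ψ).isClosed_compl

lemma isSubshift_colorings [Group Γ] {g : FPC Γ → Bool}
    (hg : ∀ γ φ, g φ = true → g (shiftP γ φ) = true) : IsSubshift (colorings g) := by
  refine ⟨isClosed_colorings g, fun γ ω hω ψ hψ => ?_⟩
  have h := hg γ _ (hω (shiftP γ⁻¹ ψ) fun δ c hc => ?_)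
  · convert h
    exact Subtype.ext (funext fun δ => by simp [shiftP])
  · simpa [shift] using hψ _ c hc

lemma exists_codesSubshift_iff [Group Γ] {g : FPC Γ → Bool} :
    (∃ Ω, CodesSubshift g Ω) ↔
    ∃ e : FPC Γ → Γ → ℕ, (∀ γ φ, g φ = true → g (shiftP γ φ) = true) ∧
      ∀ φ, g φ = true → Extends (e φ) φ ∧ ∀ ψ, Extends (e φ) ψ → g ψ = true := by
  constructor
  · rintro ⟨Ω, ⟨-, hinv⟩, hfin⟩
    have hex : ∀ φ, ∃ ω : Γ → ℕ, g φ = true → Extends ω φ ∧ ω ∈ Ω := by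
      intro φ
      by_cases h : g φ = true
      · obtain ⟨ω, hω, hext⟩ := (hfin φ).1 h
        exact ⟨ω, fun _ => ⟨hext, hω⟩⟩
      · exact ⟨0, fun h' => absurd h' h⟩
    choose e he using hex
    refine ⟨e, fun γ φ h => ?_, fun φ h => ⟨(he φ h).1, fun ψ hψ => ?_⟩⟩
    · obtain ⟨ω, hω, hext⟩ := (hfin φ).1 h
      exact (hfin _).2 ⟨shift γ ω, hinv γ ω hω, fun δ c hc => by
        simpa [shift] using hext _ c hc⟩
    · exact (hfin ψ).2 ⟨e φ, (he φ h).2, hψ⟩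
  · rintro ⟨e, hsh, he⟩
    refine ⟨colorings g, isSubshift_colorings hsh, fun φ => ⟨fun h => ?_, ?_⟩⟩
    · exact ⟨e φ, (he φ h).2, (he φ h).1⟩
    · rintro ⟨ω, hω, hext⟩
      exact hω φ hext

section Regions

open TopologicalSpace

lemma tendsto_smul_residual {X : Type*} [TopologicalSpace X] [Group Γ] [MulAction Γ X]
    [ContinuousConstSMul Γ X] (γ : Γ) :
    Filter.Tendsto (fun x : X => γ • x) (residual X) (residual X) :=
  tendsto_residual_of_isOpenMap (continuous_const_smul γ) (isOpenMap_smul γ)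

variable {X : Type*} [TopologicalSpace X] [PolishSpace X]

/-- The open set of points that receive color `c` according to the code `s`. -/
def region (s : countableBasis X × ℕ → Bool) (c : ℕ) : Set X :=
  {x | ∃ B : countableBasis X, x ∈ B.1 ∧ s (B, c) = true}

lemma isOpen_region (s : countableBasis X × ℕ → Bool) (c : ℕ) : IsOpen (region s c) := by
  have h : region s c = ⋃ B : {B : countableBasis X // s (B, c) = true}, B.1.1 := by
    ext x
    simp only [region, mem_ofPred_eq, mem_iUnion, Subtype.exists]
    exact exists_congr fun B => by tauto
  rw [h]
  exact isOpen_iUnion fun B => isOpen_of_mem_countableBasis B.1.2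

lemma isOpen_mem_region (x : X) (c : ℕ) :
    IsOpen {s : countableBasis X × ℕ → Bool | x ∈ region s c} := by
  change IsOpen {s : countableBasis X × ℕ → Bool |
    ∃ B : countableBasis X, x ∈ B.1 ∧ s (B, c) = true}
  rw [ofPred_exists]
  refine isOpen_iUnion fun B => ?_
  by_cases hB : x ∈ B.1
  · simp only [hB, true_and]
    exact (isOpen_discrete ({true} : Set Bool)).preimage
      (continuous_apply (A := fun _ : countableBasis X × ℕ => Bool) (B, c))
  · simp [hB]

/-- `s` codes a coloring of a dense open set that only realizes patterns accepted by `g`. -/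
def IsColoringCode [Group Γ] [MulAction Γ X] (g : FPC Γ → Bool)
    (s : countableBasis X × ℕ → Bool) : Prop :=
  (∀ c c', c ≠ c' → ¬ ∃ x, x ∈ region s c ∧ x ∈ region s c') ∧
  (∀ B : countableBasis X, ∃ x ∈ B.1, ∃ c, x ∈ region s c) ∧
  ∀ φ : FPC Γ, (∃ x : X, ∀ γ c, φ.1 γ = some c → γ • x ∈ region s c) → g φ = true

lemma HasBMColoring.exists_isColoringCode [Group Γ] [Countable Γ] [MulAction Γ X]
    [ContinuousConstSMul Γ X] {g : FPC Γ → Bool} {Ω : Set (Γ → ℕ)} (hg : CodesSubshift g Ω)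
    (h : HasBMColoring X Ω) : ∃ s : countableBasis X × ℕ → Bool, IsColoringCode g s := by
  classical
  obtain ⟨f, hf, hΩ⟩ := h
  have hV : ∀ c : ℕ, ∃ V : Set X, IsOpen V ∧ f ⁻¹' {c} =ᶠ[residual X] V := fun c =>
    (baireMSet_iff.1 (hf {c} (measurableSet_singleton c))).residualEq_isOpen
  choose V hVo hVe using hV
  have hreg : ∀ c, region (fun p : countableBasis X × ℕ => decide (p.1.1 ⊆ V p.2)) c = V c := by
    intro c
    ext x
    simp only [region, mem_ofPred_eq, decide_eq_true_eq]
    constructor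
    · rintro ⟨B, hx, hB⟩
      exact hB hx
    · intro hx
      obtain ⟨B, hB, hxB, hBV⟩ :=
        (isBasis_countableBasis X).exists_subset_of_mem_open hx (hVo c)
      exact ⟨⟨B, hB⟩, hxB, hBV⟩
  have hG : ∀ᶠ x in residual X, ∀ (γ : Γ) (c : ℕ), f (γ • x) = c ↔ γ • x ∈ V c := by
    refine eventually_countable_forall.2 fun γ => ?_
    refine (tendsto_smul_residual γ).eventually
      (p := fun y => ∀ c, f y = c ↔ y ∈ V c) ?_
    exact eventually_countable_forall.2 fun c => (Filter.eventuallyEq_set.1 (hVe c)).mono fun x hx => hx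
  have hd : Dense {x : X | (∀ (γ : Γ) (c : ℕ), f (γ • x) = c ↔ γ • x ∈ V c) ∧
      codingMap f x ∈ Ω} := dense_of_mem_residual (hG.and hΩ)
  refine ⟨fun p => decide (p.1.1 ⊆ V p.2), ?_, ?_, ?_⟩
  · rintro c c' hcc ⟨x, hx, hx'⟩
    rw [hreg] at hx hx'
    obtain ⟨y, ⟨hy, hy'⟩, hyG, -⟩ := hd.inter_open_nonempty _ ((hVo c).inter (hVo c')) ⟨x, hx, hx'⟩
    have h1 := hyG 1
    simp only [one_smul] at h1
    exact hcc (((h1 c).2 hy).symm.trans ((h1 c').2 hy'))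
  · intro B
    obtain ⟨y, hyB, hyG, -⟩ := hd.inter_open_nonempty _ (isOpen_of_mem_countableBasis B.2)
      (nonempty_of_mem_countableBasis B.2)
    refine ⟨y, hyB, f y, ?_⟩
    rw [hreg]
    have h1 := hyG 1 (f y)
    simpa only [one_smul, true_iff] using h1
  · rintro φ ⟨x, hx⟩
    simp only [hreg] at hx
    have hW : IsOpen {x : X | ∀ γ c, φ.1 γ = some c → γ • x ∈ V c} := by
      have h : {x : X | ∀ γ c, φ.1 γ = some c → γ • x ∈ V c} =
          ⋂ γ ∈ {γ : Γ | φ.1 γ ≠ none}, (fun x : X => γ • x) ⁻¹' V ((φ.1 γ).getD 0) := by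
        ext x
        simp only [mem_ofPred_eq, mem_iInter, mem_preimage]
        constructor
        · intro h γ hγ
          obtain ⟨c, hc⟩ := Option.ne_none_iff_exists'.1 hγ
          rw [hc]
          exact h γ c hc
        · intro h γ c hc
          simpa [hc] using h γ (by simp [hc])
      rw [h]
      exact φ.2.isOpen_biInter fun γ _ => (hVo _).preimage (continuous_const_smul γ)
    obtain ⟨y, hyW, hyG, hyΩ⟩ := hd.inter_open_nonempty _ hW ⟨x, hx⟩
    exact (hg.2 φ).2 ⟨_, hyΩ, fun γ c hc => (hyG γ c).2 (hyW γ c hc)⟩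

lemma IsColoringCode.hasBMColoring [Group Γ] [Countable Γ] [MulAction Γ X]
    [ContinuousConstSMul Γ X] {g : FPC Γ → Bool} {Ω : Set (Γ → ℕ)} (hg : CodesSubshift g Ω)
    {s : countableBasis X × ℕ → Bool} (hs : IsColoringCode g s) : HasBMColoring X Ω := by
  classical
  obtain ⟨hdisj, hdense, hpat⟩ := hs
  have hD : (⋃ c, region s c) ∈ residual X := by
    refine residual_of_dense_open (isOpen_iUnion fun c => isOpen_region s c) ?_
    rw [(isBasis_countableBasis X).dense_iff]
    intro B hB _
    obtain ⟨x, hx, c, hc⟩ := hdense ⟨B, hB⟩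
    exact ⟨x, hx, mem_iUnion.2 ⟨c, hc⟩⟩
  let f : X → ℕ := fun x => if h : ∃ c, x ∈ region s c then h.choose else 0
  have hf : ∀ x c, x ∈ region s c → f x = c := by
    intro x c hx
    have h : ∃ c, x ∈ region s c := ⟨c, hx⟩
    simp only [f, dif_pos h]
    by_contra hne
    exact hdisj _ _ hne ⟨x, h.choose_spec, hx⟩
  refine ⟨f, fun A _ => baireMSet_iff.2 ?_, ?_⟩
  · have ho : BaireMeasurableSet (⋃ c ∈ A, region s c) :=
      (isOpen_biUnion fun c _ => isOpen_region s c).baireMeasurableSet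
    refine ho.congr (Filter.eventuallyEq_set.2 ?_)
    filter_upwards [hD] with x hx
    obtain ⟨c, hc⟩ := mem_iUnion.1 hx
    simp only [mem_iUnion, mem_preimage, exists_prop]
    constructor
    · rintro ⟨d, hd, hxd⟩
      rwa [hf x d hxd]
    · intro h
      rw [hf x c hc] at h
      exact ⟨c, h, hc⟩
  · have hG : ∀ᶠ x in residual X, ∀ γ : Γ, γ • x ∈ ⋃ c, region s c :=
      eventually_countable_forall.2 fun γ => (tendsto_smul_residual γ).eventually hD
    filter_upwards [hG] with x hx
    refine mem_of_isClosed hg.1.1 fun φ hφ => (hg.2 φ).1 (hpat φ ⟨x, fun γ c hc => ?_⟩)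
    obtain ⟨d, hd⟩ := mem_iUnion.1 (hx γ)
    have h1 := hφ γ c hc
    have h2 := hf _ d hd
    simp only [codingMap] at h1
    rwa [← h1, h2]

lemma measurableSet_isColoringCode [Group Γ] [Countable Γ] [MulAction Γ X] :
    MeasurableSet {p : (FPC Γ → Bool) × (countableBasis X × ℕ → Bool) |
      IsColoringCode p.1 p.2} := by
  have hreg : ∀ (x : X) c, IsOpen {p : (FPC Γ → Bool) × (countableBasis X × ℕ → Bool) |
      x ∈ region p.2 c} := fun x c => (isOpen_mem_region x c).preimage continuous_snd
  have hg : ∀ φ, MeasurableSet {p : (FPC Γ → Bool) × (countableBasis X × ℕ → Bool) |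
      p.1 φ = true} := fun φ => measurableSet_setOfPred.2 (by fun_prop)
  simp only [IsColoringCode, ofPred_and, ofPred_forall]
  refine .inter (.iInter fun c => .iInter fun c' => .iInter fun _ => ?_)
    (.inter (.iInter fun B => ?_) (.iInter fun φ => ?_))
  · rw [← compl_ofPred, ofPred_exists]
    exact (isOpen_iUnion fun x => (hreg x c).inter (hreg x c')).measurableSet.compl
  · simp only [ofPred_exists, ofPred_and]
    exact (isOpen_iUnion fun x => isOpen_const.inter (isOpen_iUnion fun c => hreg x c)).measurableSet
  · have ho : IsOpen {p : (FPC Γ → Bool) × (countableBasis X × ℕ → Bool) |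
        ∃ x : X, ∀ γ c, φ.1 γ = some c → γ • x ∈ region p.2 c} := by
      rw [ofPred_exists]
      refine isOpen_iUnion fun x => ?_
      have h : {p : (FPC Γ → Bool) × (countableBasis X × ℕ → Bool) |
          ∀ γ c, φ.1 γ = some c → γ • x ∈ region p.2 c} =
          ⋂ γ ∈ {γ : Γ | φ.1 γ ≠ none}, {p | γ • x ∈ region p.2 ((φ.1 γ).getD 0)} := by
        ext p
        simp only [mem_ofPred_eq, mem_iInter]
        constructor
        · intro h γ hγ
          obtain ⟨c, hc⟩ := Option.ne_none_iff_exists'.1 hγ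
          rw [hc]
          exact h γ c hc
        · intro h γ c hc
          simpa [hc] using h γ (by simp [hc])
      rw [h]
      exact φ.2.isOpen_biInter fun γ _ => hreg _ _
    exact ho.measurableSet.himp (hg φ)

lemma measurableSet_extendor [Group Γ] [Countable Γ] :
    MeasurableSet {p : (FPC Γ → Bool) × (FPC Γ → Γ → ℕ) |
      (∀ γ φ, p.1 φ = true → p.1 (shiftP γ φ) = true) ∧
      ∀ φ, p.1 φ = true → Extends (p.2 φ) φ ∧ ∀ ψ, Extends (p.2 φ) ψ → p.1 ψ = true} := by
  have hg : ∀ φ, Measurable fun p : (FPC Γ → Bool) × (FPC Γ → Γ → ℕ) => p.1 φ = true := by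
    fun_prop
  have hext : ∀ φ ψ, Measurable fun p : (FPC Γ → Bool) × (FPC Γ → Γ → ℕ) =>
      Extends (p.2 φ) ψ := fun φ ψ =>
    measurableSet_setOfPred.1 ((isOpen_extends ψ).measurableSet.preimage (by fun_prop))
  refine measurableSet_setOfPred.2 (.and (.forall fun γ => .forall fun φ => (hg φ).imp (hg _))
    (.forall fun φ => (hg φ).imp (.and (hext φ φ) (.forall fun ψ => (hext φ ψ).imp (hg ψ)))))

lemma analyticSet_colorable [Group Γ] [Countable Γ] [MulAction Γ X] [ContinuousConstSMul Γ X] :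
    MeasureTheory.AnalyticSet
      {g : FPC Γ → Bool | ∃ Ω : Set (Γ → ℕ), CodesSubshift g Ω ∧ HasBMColoring X Ω} := by
  have h : {g : FPC Γ → Bool | ∃ Ω : Set (Γ → ℕ), CodesSubshift g Ω ∧ HasBMColoring X Ω} =
      Prod.fst '' {p : (FPC Γ → Bool) × (FPC Γ → Γ → ℕ) |
        (∀ γ φ, p.1 φ = true → p.1 (shiftP γ φ) = true) ∧
        ∀ φ, p.1 φ = true → Extends (p.2 φ) φ ∧ ∀ ψ, Extends (p.2 φ) ψ → p.1 ψ = true} ∩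
      Prod.fst '' {p : (FPC Γ → Bool) × (countableBasis X × ℕ → Bool) |
        IsColoringCode p.1 p.2} := by
    ext g
    simp only [mem_inter_iff, mem_image, mem_ofPred_eq, Prod.exists, exists_and_right,
      exists_eq_right]
    rw [← exists_codesSubshift_iff]
    constructor
    · rintro ⟨Ω, hΩ, hX⟩
      exact ⟨⟨Ω, hΩ⟩, hX.exists_isColoringCode hΩ⟩
    · rintro ⟨⟨Ω, hΩ⟩, s, hs⟩
      exact ⟨Ω, hΩ, hs.hasBMColoring hΩ⟩
  have : PolishSpace Bool := inferInstance
  rw [h, inter_eq_iInter]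
  refine MeasureTheory.AnalyticSet.iInter fun b => ?_
  cases b
  · exact measurableSet_isColoringCode.analyticSet.image_of_continuous continuous_fst
  · exact measurableSet_extendor.analyticSet.image_of_continuous continuous_fst

end Regions

/-- Decreasing sets of markers: at each stage, every orbit retains the part inside `H n` if that
part is infinite, and the part outside `H n` otherwise. -/
def markers (Γ : Type*) [Group Γ] {X : Type*} [MulAction Γ X] (H : ℕ → Set X) : ℕ → Set X
  | 0 => univ
  | n + 1 => markers Γ H n ∩ {x | x ∈ H n ↔ {γ : Γ | γ • x ∈ markers Γ H n ∩ H n}.Infinite}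

lemma infinite_smul_mem_iff [Group Γ] {X : Type*} [MulAction Γ X] (S : Set X) (δ : Γ) (x : X) :
    {γ : Γ | γ • δ • x ∈ S}.Infinite ↔ {γ : Γ | γ • x ∈ S}.Infinite := by
  have h : {γ : Γ | γ • δ • x ∈ S} = (Equiv.mulRight δ) ⁻¹' {γ : Γ | γ • x ∈ S} := by
    ext γ
    simp [mul_smul]
  rw [h, ← Equiv.image_symm_eq_preimage, infinite_image_iff (Equiv.injective _).injOn]

lemma infinite_markers [Group Γ] [Infinite Γ] {X : Type*} [MulAction Γ X] (H : ℕ → Set X)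
    (n : ℕ) (x : X) : {γ : Γ | γ • x ∈ markers Γ H n}.Infinite := by
  induction n with
  | zero => simpa [markers] using infinite_univ
  | succ n ih =>
    simp only [markers, mem_inter_iff, mem_ofPred_eq]
    by_cases h : {γ : Γ | γ • x ∈ markers Γ H n ∩ H n}.Infinite
    · refine h.mono fun γ hγ => ⟨hγ.1, ?_⟩
      have := (infinite_smul_mem_iff (markers Γ H n ∩ H n) γ x).2 h
      exact iff_of_true hγ.2 this
    · refine (ih.sdiff (not_infinite.1 h)).mono fun γ hγ => ⟨hγ.1, ?_⟩
      have := mt (infinite_smul_mem_iff (markers Γ H n ∩ H n) γ x).1 h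
      exact iff_of_false (fun h' => hγ.2 ⟨hγ.1, h'⟩) this

lemma measurableSet_infinite_smul [Group Γ] [Countable Γ] {X : Type*} [MulAction Γ X]
    [MeasurableSpace X] [MeasurableConstSMul Γ X] {S : Set X} (hS : MeasurableSet S) :
    MeasurableSet {x : X | {γ : Γ | γ • x ∈ S}.Infinite} := by
  have h : {x : X | {γ : Γ | γ • x ∈ S}.Infinite} =
      ⋂ F : Finset Γ, ⋃ γ : {γ : Γ // γ ∉ F}, (fun x => γ.1 • x) ⁻¹' S := by
    ext x
    simp only [mem_ofPred_eq, mem_iInter, mem_iUnion, mem_preimage, Subtype.exists, exists_prop]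
    constructor
    · intro h F
      obtain ⟨γ, hγ, hF⟩ := h.exists_notMem_finset F
      exact ⟨γ, hF, hγ⟩
    · intro h hfin
      obtain ⟨γ, hγ, hS⟩ := h hfin.toFinset
      exact hγ (by simpa using hS)
  rw [h]
  exact .iInter fun F => .iUnion fun γ => (measurable_const_smul γ.1) hS

lemma measurableSet_markers [Group Γ] [Countable Γ] {X : Type*} [MulAction Γ X]
    [MeasurableSpace X] [MeasurableConstSMul Γ X] {H : ℕ → Set X}
    (hH : ∀ n, MeasurableSet (H n)) (n : ℕ) : MeasurableSet (markers Γ H n) := by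
  induction n with
  | zero => exact .univ
  | succ n ih =>
    exact ih.inter (measurableSet_setOfPred.2 (.iff (measurableSet_setOfPred.1 (hH n))
      (measurableSet_setOfPred.1 (measurableSet_infinite_smul (ih.inter (hH n))))))

/-- A free Borel action of an infinite group admits a Borel function to `ℕ` that is unbounded on
every orbit. -/
lemma exists_measurable_unbounded [Group Γ] [Countable Γ] [Infinite Γ] {X : Type*} [MulAction Γ X]
    [MeasurableSpace X] [MeasurableConstSMul Γ X] [MeasurableSpace.CountablySeparated X]
    (hfree : ∀ (γ : Γ) (x : X), γ • x = x → γ = 1) :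
    ∃ f : X → ℕ, Measurable f ∧ ∀ x n, ∃ γ : Γ, n < f (γ • x) := by
  classical
  obtain ⟨H, hH, hsep⟩ := exists_seq_separating X (p := MeasurableSet) .empty univ
  have hS : ∀ n, MeasurableSet (markers Γ H n) := measurableSet_markers hH
  have hanti : Antitone (markers Γ H) := antitone_nat_of_succ_le fun n => inter_subset_left
  have hinter : ∀ (x : X) (γ : Γ), x ∈ ⋂ n, markers Γ H n → γ • x ∈ ⋂ n, markers Γ H n → γ = 1 := by
    intro x γ hx hγ
    refine hfree γ x (hsep _ trivial _ trivial fun n => ?_)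
    have h1 := (mem_iInter.1 hx (n + 1)).2
    have h2 := (mem_iInter.1 hγ (n + 1)).2
    rw [mem_ofPred_eq] at h1 h2
    rw [h1, h2, infinite_smul_mem_iff]
  have hI : MeasurableSet (⋂ n, markers Γ H n) := .iInter hS
  have hex : ∀ x, ∃ n, x ∈ ⋂ n, markers Γ H n ∨ x ∉ markers Γ H n := by
    intro x
    by_cases h : x ∈ ⋂ n, markers Γ H n
    · exact ⟨0, .inl h⟩
    · simp only [mem_iInter, not_forall] at h
      exact h.imp fun n hn => .inr hn
  refine ⟨fun x => Nat.find (hex x), measurable_find hex fun n => hI.union (hS n).compl, ?_⟩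
  intro x n
  have hsub : {γ : Γ | γ • x ∈ ⋂ n, markers Γ H n}.Subsingleton := by
    intro γ hγ δ hδ
    have := hinter (γ • x) (δ * γ⁻¹) hγ (by simpa [← mul_smul] using hδ)
    exact (mul_inv_eq_one.1 this).symm
  obtain ⟨γ, hγ, hγ'⟩ := ((infinite_markers H n x).sdiff hsub.finite).nonempty
  refine ⟨γ, (Nat.lt_find_iff _ _).2 fun m hm => ?_⟩
  rintro (h | h)
  · exact hγ' h
  · exact h (hanti hm hγ)

section Pointers

variable {N : Type*}

/-- The subshift of pointer colorings. A point is colored either by `none` (at most one point per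
orbit), or by a node `a : N` and an element of `Γ` pointing to a point that is colored either by
`none` or by a node `a'` with `R a a'`. Colors are natural numbers via the bijection `e`. -/
def pointerShift [Group Γ] (e : ℕ ≃ Option (N × Γ)) (R : N → N → Prop) : Set (Γ → ℕ) :=
  {ω | (∀ δ δ', e (ω δ) = none → e (ω δ') = none → δ = δ') ∧
    ∀ δ a γ, e (ω δ) = some (a, γ) →
      e (ω (γ * δ)) = none ∨ ∃ a' γ', e (ω (γ * δ)) = some (a', γ') ∧ R a a'}

lemma isSubshift_pointerShift [Group Γ] (e : ℕ ≃ Option (N × Γ)) (R : N → N → Prop) :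
    IsSubshift (pointerShift e R) := by
  constructor
  · have h1 : ∀ (γ : Γ) (S : Set ℕ), IsClosed {ω : Γ → ℕ | ω γ ∈ S} := fun γ S =>
      (isClosed_discrete S).preimage (continuous_apply (A := fun _ : Γ => ℕ) γ)
    have h2 : ∀ (γ : Γ) (S : Set ℕ), IsOpen {ω : Γ → ℕ | ω γ ∈ S} := fun γ S =>
      (isOpen_discrete S).preimage (continuous_apply (A := fun _ : Γ => ℕ) γ)
    simp only [pointerShift, ofPred_and, ofPred_forall]
    refine .inter (isClosed_iInter fun δ => isClosed_iInter fun δ' => ?_)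
      (isClosed_iInter fun δ => isClosed_iInter fun a => isClosed_iInter fun γ => ?_)
    · exact isClosed_imp (h2 δ {c | e c = none})
        (isClosed_imp (h2 δ' {c | e c = none}) isClosed_const)
    · exact isClosed_imp (h2 δ {c | e c = some (a, γ)})
        (h1 (γ * δ) {c | e c = none ∨ ∃ a' γ', e c = some (a', γ') ∧ R a a'})
  · rintro γ ω ⟨h1, h2⟩
    refine ⟨fun δ δ' h h' => mul_right_cancel (h1 _ _ h h'), fun δ a γ' h => ?_⟩
    simpa only [shift, mul_assoc] using h2 (δ * γ) a γ' h

/-- The coloring that agrees with `ψ` on its domain, in which every other point carries the default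
node and points to `η`. -/
def fillP [Group Γ] [Inhabited N] [DecidableEq Γ] (e : ℕ ≃ Option (N × Γ)) (η : Γ) (ψ : FPC Γ) :
    Γ → ℕ :=
  fun δ => (ψ.1 δ).getD (e.symm (if δ = η then none else some (default, η * δ⁻¹)))

lemma mem_finOf_pointerShift [Group Γ] [Infinite Γ] [Inhabited N] [DecidableEq Γ]
    (e : ℕ ≃ Option (N × Γ)) (R : N → N → Prop) (φ : FPC Γ) :
    φ ∈ FinOf (pointerShift e R) ↔
      ∃ η ψ, Extends (fillP e η ψ) φ ∧ fillP e η ψ ∈ pointerShift e R := by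
  refine ⟨?_, fun ⟨η, ψ, h, h'⟩ => ⟨_, h', h⟩⟩
  rintro ⟨ω, ⟨h1, h2⟩, hφ⟩
  let S : Finset Γ := φ.2.toFinset
  let S' : Finset Γ := S ∪ S.image fun δ => ((e (ω δ)).elim 1 Prod.snd) * δ
  obtain ⟨η, hη, hη'⟩ : ∃ η, (∀ δ, e (ω δ) = none → δ = η) ∧ (e (ω η) = none ∨ η ∉ S) := by
    by_cases h : ∃ η, e (ω η) = none
    · obtain ⟨η, hη⟩ := h
      exact ⟨η, fun δ hδ => h1 _ _ hδ hη, .inl hη⟩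
    · obtain ⟨η, hη⟩ := Infinite.exists_notMem_finset S
      exact ⟨η, fun δ hδ => absurd ⟨δ, hδ⟩ h, .inr hη⟩
  let ω' : Γ → ℕ := fun δ => if δ ∈ S then ω δ else e.symm (if δ = η then none else
    some (if δ ∈ S' then (e (ω δ)).elim default Prod.fst else default, η * δ⁻¹))
  have hfill : fillP e η (restrictTo ω' S') = ω' := by
    ext δ
    simp only [fillP, restrictTo]
    by_cases hδ : δ ∈ S'
    · simp [hδ]
    · have hδS : δ ∉ S := fun h => hδ (Finset.mem_union_left _ h)
      simp [hδ, hδS, ω']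
  have hS : ∀ δ ∈ S, ω' δ = ω δ := fun δ hδ => by simp [ω', hδ]
  have hcenter : e (ω' η) = none := by
    by_cases h : η ∈ S
    · rw [hS η h]
      exact hη'.resolve_right (not_not_intro h)
    · simp [ω', h]
  have hnone : ∀ δ, e (ω' δ) = none → δ = η := by
    intro δ hδ
    by_cases h : δ ∈ S
    · rw [hS δ h] at hδ
      exact hη δ hδ
    · by_contra hne
      simp [ω', h, hne] at hδ
  have htarget : ∀ δ ∈ S', ∀ a γ, e (ω δ) = some (a, γ) →
      e (ω' δ) = none ∨ ∃ γ', e (ω' δ) = some (a, γ') := by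
    intro δ hδ a γ h
    by_cases hδS : δ ∈ S
    · exact .inr ⟨γ, by rw [hS δ hδS, h]⟩
    · by_cases hδη : δ = η
      · exact .inl (hδη ▸ hcenter)
      · exact .inr ⟨η * δ⁻¹, by simp [ω', hδS, hδη, hδ, h]⟩
  refine ⟨η, restrictTo ω' S', ?_⟩
  rw [hfill]
  refine ⟨fun γ c hc => ?_, fun δ δ' h h' => (hnone δ h).trans (hnone δ' h').symm, ?_⟩
  · rw [hS γ (by simp [S, hc])]
    exact hφ γ c hc
  · intro δ a γ h
    by_cases hδ : δ ∈ S
    · rw [hS δ hδ] at h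
      have hmem : γ * δ ∈ S' :=
        Finset.mem_union_right _ (Finset.mem_image.2 ⟨δ, hδ, by simp [h]⟩)
      rcases h2 δ a γ h with h0 | ⟨a', γ', h', hR⟩
      · rw [hη _ h0]
        exact .inl hcenter
      · exact (htarget _ hmem a' γ' h').imp_right fun ⟨γ'', h''⟩ => ⟨a', γ'', h'', hR⟩
    · by_cases hδη : δ = η
      · rw [hδη, hcenter] at h
        exact absurd h (by simp)
      · simp only [ω', hδ, hδη, if_false, Equiv.apply_symm_apply, Option.some.injEq,
          Prod.mk.injEq] at h
        left
        rw [← h.2, inv_mul_cancel_right]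
        exact hcenter

/-- The shift of pointer colorings over a Borel family of relations is coded in a Borel way. -/
lemma measurable_finOf_pointerShift [Group Γ] [Countable Γ] [Infinite Γ] [Countable N]
    [Inhabited N] {Z : Type*} [MeasurableSpace Z] (e : ℕ ≃ Option (N × Γ)) {R : Z → N → N → Prop}
    (hR : ∀ a a', MeasurableSet {z | R z a a'}) (φ : FPC Γ) :
    MeasurableSet {z | φ ∈ FinOf (pointerShift e (R z))} := by
  classical
  simp only [mem_finOf_pointerShift]
  refine measurableSet_setOfPred.2 (.exists fun η => .exists fun ψ => .and measurable_const ?_)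
  exact .and measurable_const (.forall fun δ => .forall fun a => .forall fun γ =>
    measurable_const.imp (.or measurable_const (.exists fun a' => .exists fun γ' =>
      measurable_const.and (measurableSet_setOfPred.1 (hR a a')))))

lemma hasBMColoring_pointerShift [Group Γ] [Countable Γ] [Infinite Γ]
    {X : Type*} [TopologicalSpace X] [PolishSpace X] [MulAction Γ X] [ContinuousConstSMul Γ X]
    (hfree : ∀ (γ : Γ) (x : X), γ • x = x → γ = 1) (e : ℕ ≃ Option (N × Γ))
    {R : N → N → Prop} {b : ℕ → N} (hb : ∀ m n, m < n → R (b m) (b n)) :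
    HasBMColoring X (pointerShift e R) := by
  classical
  borelize X
  obtain ⟨f, hf, hunb⟩ := exists_measurable_unbounded hfree
  obtain ⟨u, hu⟩ := exists_surjective_nat Γ
  have hex : ∀ x : X, ∃ k, f x < f (u k • x) := fun x => by
    obtain ⟨γ, hγ⟩ := hunb x (f x)
    obtain ⟨k, rfl⟩ := hu γ
    exact ⟨k, hγ⟩
  have hk : Measurable fun x => Nat.find (hex x) := measurable_find hex fun k =>
    measurableSet_lt hf (hf.comp (measurable_const_smul (u k)))
  let p : X → ℕ := fun x => e.symm (some (b (f x), u (Nat.find (hex x))))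
  have hp : Measurable p :=
    (Measurable.of_discrete (f := fun q : ℕ × ℕ => e.symm (some (b q.1, u q.2)))).comp
      (hf.prodMk hk)
  refine ⟨p, fun B hB => baireMSet_iff.2 (hp hB).baireMeasurableSet, Filter.univ_mem' fun x => ?_⟩
  refine ⟨fun δ δ' h => ?_, fun δ a γ h => .inr ?_⟩
  · simp [codingMap, p] at h
  · simp only [codingMap, p, Equiv.apply_symm_apply, Option.some.injEq, Prod.mk.injEq] at h ⊢
    refine ⟨_, _, ⟨rfl, rfl⟩, ?_⟩
    rw [← h.1, mul_smul, ← h.2]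
    exact hb _ _ (Nat.find_spec (hex (δ • x)))

lemma exists_none_of_mem_pointerShift [Group Γ] {e : ℕ ≃ Option (N × Γ)} {R : N → N → Prop}
    (hR : ¬ ∃ b : ℕ → N, ∀ n, R (b n) (b (n + 1))) {ω : Γ → ℕ} (hω : ω ∈ pointerShift e R) :
    ∃ δ, e (ω δ) = none := by
  by_contra! h
  have hstep : ∀ δ : Γ, ∃ δ', ∃ a a' γ γ', e (ω δ) = some (a, γ) ∧ e (ω δ') = some (a', γ') ∧
      R a a' := by
    intro δ
    obtain ⟨⟨a, γ⟩, hδ⟩ := Option.ne_none_iff_exists'.1 (h δ)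
    obtain ⟨a', γ', h', hR'⟩ := (hω.2 δ a γ hδ).resolve_left (h _)
    exact ⟨γ * δ, a, a', γ, γ', hδ, h', hR'⟩
  choose s a a' γ γ' h1 h2 h3 using hstep
  refine hR ⟨fun n => a (s^[n] 1), fun n => ?_⟩
  change R (a (s^[n] 1)) (a (s^[n + 1] 1))
  rw [Function.iterate_succ_apply']
  have h4 := h2 (s^[n] 1)
  rw [h1 (s _), Option.some.injEq, Prod.mk.injEq] at h4
  rw [h4.1]
  exact h3 _

lemma genSmooth_of_hasBMColoring_pointerShift [Group Γ] [Countable Γ]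
    {X : Type*} [TopologicalSpace X] [PolishSpace X] [MulAction Γ X] [ContinuousConstSMul Γ X]
    {e : ℕ ≃ Option (N × Γ)} {R : N → N → Prop}
    (hR : ¬ ∃ b : ℕ → N, ∀ n, R (b n) (b (n + 1))) (h : HasBMColoring X (pointerShift e R)) :
    GenSmooth Γ X := by
  classical
  borelize X
  obtain ⟨f, hf, hΩ⟩ := h
  obtain ⟨j, hj⟩ := MeasureTheory.exists_measurableEmbedding_real X
  let rep : Quotient (MulAction.orbitRel Γ X) → X := fun q =>
    if h : ∃ y, Quotient.mk _ y = q ∧ e (f y) = none then h.choose else q.out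
  have hrep : ∀ q, Quotient.mk _ (rep q) = q := by
    intro q
    by_cases h : ∃ y, Quotient.mk (MulAction.orbitRel Γ X) y = q ∧ e (f y) = none
    · simp only [rep, dif_pos h]
      exact h.choose_spec.1
    · simp only [rep, dif_neg h]
      exact q.out_eq
  have hrep' : ∀ x, codingMap f x ∈ pointerShift e R → ∀ δ : Γ, e (f (δ • x)) = none →
      rep (Quotient.mk _ x) = δ • x := by
    intro x hx δ hδ
    have h : ∃ y, Quotient.mk (MulAction.orbitRel Γ X) y = Quotient.mk _ x ∧ e (f y) = none :=
      ⟨δ • x, Quotient.sound (MulAction.orbitRel_apply.2 ⟨δ, rfl⟩), hδ⟩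
    simp only [rep, dif_pos h]
    obtain ⟨h1, h2⟩ := h.choose_spec
    obtain ⟨δ', hδ'⟩ := MulAction.orbitRel_apply.1 (Quotient.exact h1)
    rw [← hδ']
    simp only [← hδ'] at h2
    rw [hx.1 δ' δ h2 hδ]
  refine ⟨fun x => j (rep (Quotient.mk _ x)), fun B hB => baireMSet_iff.2 ?_, fun x y => ?_⟩
  · have hm : BaireMeasurableSet (⋃ δ : Γ, (fun x : X => δ • x) ⁻¹'
        (f ⁻¹' {c | e c = none} ∩ j ⁻¹' B)) := by
      refine .iUnion fun δ => BaireMeasurableSet.preimage (continuous_const_smul δ)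
        (isOpenMap_smul δ) ((baireMSet_iff.1 (hf _ ?_)).inter
          (hj.measurable hB).baireMeasurableSet)
      exact MeasurableSet.of_discrete
    refine hm.congr (Filter.eventuallyEq_set.2 ?_)
    filter_upwards [hΩ] with x hx
    simp only [mem_iUnion, mem_preimage, mem_inter_iff]
    constructor
    · rintro ⟨δ, hδ, hB⟩
      rwa [hrep' x hx δ hδ]
    · intro h
      obtain ⟨δ, hδ⟩ := exists_none_of_mem_pointerShift hR hx
      exact ⟨δ, hδ, by rwa [← hrep' x hx δ hδ]⟩
  · rw [hj.injective.eq_iff]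
    constructor
    · intro h
      have h' := congrArg (Quotient.mk (MulAction.orbitRel Γ X)) h
      rw [hrep, hrep] at h'
      exact MulAction.orbitRel_apply.1 (Quotient.exact h'.symm)
    · intro h
      exact congrArg rep (Quotient.sound (MulAction.orbitRel_apply.2 h)).symm

end Pointers

/-- An analytic set is the set of points at which some closed family of strict extension relations
on finite sequences is ill-founded. -/
lemma exists_relation_of_analyticSet {Z : Type*} [TopologicalSpace Z] [T2Space Z]
    {B : Set Z} (hB : MeasureTheory.AnalyticSet B) :
    ∃ R : Z → List ℕ → List ℕ → Prop, (∀ a a', IsClosed {z | R z a a'}) ∧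
      (∀ z ∈ B, ∃ b : ℕ → List ℕ, ∀ m n, m < n → R z (b m) (b n)) ∧
      ∀ z, (∃ b : ℕ → List ℕ, ∀ n, R z (b n) (b (n + 1))) → z ∈ B := by
  rw [MeasureTheory.AnalyticSet] at hB
  rcases hB with rfl | ⟨F, hF, rfl⟩
  · exact ⟨fun _ _ _ => False, by simp, by simp, by simp⟩
  let C : List ℕ → Set (ℕ → ℕ) := fun s => {x | (List.range s.length).map x = s}
  refine ⟨fun z s s' => (s <+: s' ∧ s.length < s'.length) ∧ z ∈ closure (F '' C s'), ?_, ?_, ?_⟩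
  · intro a a'
    change IsClosed ({_z : Z | a <+: a' ∧ a.length < a'.length} ∩ closure (F '' C a'))
    exact isClosed_const.inter isClosed_closure
  · rintro _ ⟨x, rfl⟩
    refine ⟨fun n => (List.range n).map x, fun m n hmn => ⟨⟨?_, by simpa using hmn⟩, ?_⟩⟩
    · refine List.IsPrefix.map _ ?_
      rw [List.prefix_iff_eq_take]
      simp [hmn.le]
    · exact subset_closure ⟨x, by simp [C], rfl⟩
  · rintro z ⟨b, hb⟩
    have hlen : StrictMono fun n => (b n).length := strictMono_nat_of_lt_succ fun n => (hb n).1.2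
    have hpre : ∀ m n, m ≤ n → b m <+: b n := by
      intro m n hmn
      induction n, hmn using Nat.le_induction with
      | base => exact List.prefix_rfl
      | succ n _ ih => exact ih.trans (hb n).1.1
    let x : ℕ → ℕ := fun i => (b (i + 1)).getD i 0
    have hx : ∀ n, ∀ y ∈ C (b n), ∀ i < n, y i = x i := by
      intro n y hy i hi
      have hi1 : i < (b (i + 1)).length := (Nat.lt_succ_self i).trans_le (hlen.le_apply)
      have hi2 : i < (b n).length := hi.trans_le hlen.le_apply
      have h1 : y i = (b n)[i] := by
        have h3 : (b n)[i] = ((List.range (b n).length).map y)[i]'(by simpa using hi2) := by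
          congr 1
          exact hy.symm
        rw [h3]
        simp
      rw [h1]
      simp only [x, List.getD_eq_getElem _ _ hi1]
      exact ((hpre (i + 1) n hi).getElem hi1).symm
    refine ⟨x, ?_⟩
    by_contra hne
    obtain ⟨u, v, hu, hv, hxu, hzv, hd⟩ := t2_separation hne
    obtain ⟨I, w, hw, hIw⟩ := isOpen_pi_iff.1 (hu.preimage hF) x hxu
    obtain ⟨_, hyv, y, hy, rfl⟩ := mem_closure_iff.1 (hb (I.sup id)).2 v hv hzv
    refine disjoint_left.1 hd (hIw fun i hi => ?_) hyv
    rw [hx _ y hy i (Nat.lt_succ_of_le (Finset.le_sup (f := id) hi))]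
    exact (hw i hi).2

/-- For a free continuous non-generically-smooth action of `Γ` on a nonempty Polish
space, the set of (codes of) subshifts admitting a Baire measurable coloring is
complete analytic. -/
theorem stmt1 {Γ : Type*} [Group Γ] [Countable Γ] [Infinite Γ]
    (X : Type*) [TopologicalSpace X] [PolishSpace X] [Nonempty X] [MulAction Γ X]
    (hcont : ∀ γ : Γ, Continuous fun x : X => γ • x)
    (hfree : ∀ (γ : Γ) (x : X), γ • x = x → γ = 1)
    (hnotsmooth : ¬ GenSmooth Γ X) :
    MeasureTheory.AnalyticSet
      {g : FPC Γ → Bool | ∃ Ω : Set (Γ → ℕ), CodesSubshift g Ω ∧ HasBMColoring X Ω} ∧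
    ∀ (Z : Type*) [TopologicalSpace Z] [PolishSpace Z] [MeasurableSpace Z] [BorelSpace Z]
      (B : Set Z), MeasureTheory.AnalyticSet B →
      ∃ g : Z → FPC Γ → Bool, Measurable g ∧
        (∀ z : Z, ∃ Ω : Set (Γ → ℕ), CodesSubshift (g z) Ω) ∧
        (∀ z : Z, z ∈ B ↔
          ∃ Ω : Set (Γ → ℕ), CodesSubshift (g z) Ω ∧ HasBMColoring X Ω) := by
  classical
  have : ContinuousConstSMul Γ X := ⟨hcont⟩
  refine ⟨analyticSet_colorable, fun Z _ _ _ _ B hB => ?_⟩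
  obtain ⟨R, hRc, hR1, hR2⟩ := exists_relation_of_analyticSet hB
  obtain ⟨e⟩ : Nonempty (ℕ ≃ Option (List ℕ × Γ)) := nonempty_equiv_of_countable
  have hcode : ∀ z, CodesSubshift (fun φ => decide (φ ∈ FinOf (pointerShift e (R z))))
      (pointerShift e (R z)) := fun z => ⟨isSubshift_pointerShift e _, fun φ => by simp⟩
  refine ⟨fun z φ => decide (φ ∈ FinOf (pointerShift e (R z))), measurable_pi_iff.2 fun φ => ?_,
    fun z => ⟨_, hcode z⟩, fun z => ⟨fun hz => ?_, ?_⟩⟩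
  · refine measurable_to_bool ?_
    convert measurable_finOf_pointerShift e (fun a a' => (hRc a a').measurableSet) φ using 1
    ext z
    simp
  · obtain ⟨b, hb⟩ := hR1 z hz
    exact ⟨_, hcode z, hasBMColoring_pointerShift hfree e hb⟩
  · rintro ⟨Ω, hΩ, hX⟩
    have hfin : FinOf Ω = FinOf (pointerShift e (R z)) :=
      ext fun φ => (hΩ.2 φ).symm.trans ((hcode z).2 φ)
    have hsub : Ω ⊆ pointerShift e (R z) := fun ω hω =>
      mem_of_isClosed (isSubshift_pointerShift e (R z)).1 fun φ hφ => hfin ▸ ⟨ω, hω, hφ⟩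
    by_contra hz
    obtain ⟨f, hf, hfΩ⟩ := hX
    exact hnotsmooth (genSmooth_of_hasBMColoring_pointerShift (fun h => hz (hR2 z h))
      ⟨f, hf, Filter.mem_of_superset hfΩ fun x hx => hsub hx⟩)

end DescColor
end

section
/- Let Γ be a countably infinite group. There exist a nonempty compact metrizable topological space H with no isolated points, a countable dense subset H₀ ⊆ H, and a family (Ω_h)_{h ∈ H} of subshifts of ℕ^Γ such that: (1) the map h ↦ Fin(Ω_h) is continuous, i.e., for every finite partial coloring φ of Γ, both {h ∈ H : φ ∈ Fin(Ω_h)} and {h ∈ H : φ ∉ Fin(Ω_h)} are open in H; (2) for every h ∈ H₀, the subshift Ω_h is hard; (3) for every h ∈ H ∖ H₀, the subshift Ω_h is easy. -/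
open Set Function Topology

namespace DescColor

variable {Γ : Type*}

/-! ### Baire measurability -/

section BaireMeasurability

variable {X Y : Type*} [TopologicalSpace X]

theorem baireMSet_iff_baireMeasurableSet {S : Set X} : BaireMSet S ↔ BaireMeasurableSet S := by
  rw [BaireMeasurableSet.iff_residualEq_isOpen]
  refine exists_congr fun U => and_congr_right fun _ => ?_
  rw [IsMeagre, Filter.eventuallyEq_set, Filter.Eventually]
  refine Eq.to_iff (congrArg (· ∈ residual X) ?_)
  ext x
  simp only [mem_compl_iff, mem_symmDiff, mem_setOf_eq]
  tauto

theorem _root_.Measurable.baireMFun [MeasurableSpace X] [BorelSpace X] [MeasurableSpace Y]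
    {f : X → Y} (hf : Measurable f) : BaireMFun f := fun _ hB =>
  baireMSet_iff_baireMeasurableSet.2 (hf hB).baireMeasurableSet

end BaireMeasurability

/-! ### Generic smoothness from a transversal -/

section Transversal

variable [Group Γ] {X : Type*} [TopologicalSpace X] [PolishSpace X] [MulAction Γ X]
  [ContinuousConstSMul Γ X]

/-- A Baire measurable set that meets almost every orbit, in a point with a unique translating
group element, witnesses generic smoothness. -/
theorem genSmooth_of_existsUnique_smul_mem [Countable Γ] {T : Set X} (hT : BaireMeasurableSet T)
    (h : {x : X | ∃! γ : Γ, γ • x ∈ T} ∈ residual X) : GenSmooth Γ X := by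
  borelize X
  obtain ⟨e, he⟩ := MeasureTheory.exists_measurableEmbedding_real X
  have hsel : ∀ q : MulAction.orbitRel.Quotient Γ X, ∃ y : X,
      Quotient.mk _ y = q ∧ ∀ x : X, Quotient.mk _ x = q → (∃ γ : Γ, γ • x ∈ T) → y ∈ T := by
    intro q
    by_cases hq : ∃ y ∈ T, Quotient.mk _ y = q
    · obtain ⟨y, hy, rfl⟩ := hq
      exact ⟨y, rfl, fun _ _ _ => hy⟩
    · refine ⟨q.out, Quotient.out_eq q, ?_⟩
      rintro x hx ⟨γ, hγ⟩
      refine absurd ⟨γ • x, hγ, ?_⟩ hq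
      rw [← hx]
      exact Quotient.sound (MulAction.mem_orbit x γ)
  choose g hg hgT using hsel
  refine ⟨fun x => e (g (Quotient.mk _ x)), fun B hB => ?_, fun x y => ?_⟩
  · rw [baireMSet_iff_baireMeasurableSet]
    have key : BaireMeasurableSet (⋃ γ : Γ, (γ • · : X → X) ⁻¹' (T ∩ e ⁻¹' B)) :=
      .iUnion fun γ => (hT.inter (he.measurable hB).baireMeasurableSet).preimage
        (continuous_const_smul γ) (isOpenMap_smul γ)
    refine key.congr ?_
    rw [Filter.eventuallyEq_set]
    filter_upwards [h] with x hx
    obtain ⟨δ, hδ⟩ : ∃ δ : Γ, δ • x = g (Quotient.mk _ x) :=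
      Quotient.exact (hg (Quotient.mk _ x))
    have hδT : δ • x ∈ T := hδ ▸ hgT _ x rfl hx.exists
    simp only [mem_iUnion, mem_preimage, mem_inter_iff, ← hδ]
    constructor
    · rintro ⟨γ, hγT, hγB⟩
      rwa [hx.unique hδT hγT]
    · exact fun hB => ⟨δ, hδT, hB⟩
  · rw [he.injective.eq_iff]
    constructor
    · intro hxy
      have : Quotient.mk (MulAction.orbitRel Γ X) y = Quotient.mk _ x := by
        rw [← hg (Quotient.mk _ x), hxy, hg]
      exact Quotient.exact this
    · rintro ⟨γ, rfl⟩
      exact congrArg g (Quotient.sound (MulAction.mem_orbit x γ) :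
        Quotient.mk (MulAction.orbitRel Γ X) (γ • x) = _).symm

end Transversal

/-! ### Vanishing markers -/

/-- The points of a free Borel action of an infinite countable group can be ranked in
a Borel way by natural numbers that are unbounded on every orbit. -/
theorem exists_measurable_unbounded_on_orbits [Group Γ] [Countable Γ] [Infinite Γ] {X : Type*}
    [MeasurableSpace X] [StandardBorelSpace X] [MulAction Γ X] [MeasurableConstSMul Γ X]
    (hfree : ∀ (γ : Γ) (x : X), γ • x = x → γ = 1) :
    ∃ ρ : X → ℕ, Measurable ρ ∧ ∀ (x : X) (n : ℕ), ∃ γ : Γ, n < ρ (γ • x) := by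
  obtain ⟨e₀, he₀⟩ := MeasureTheory.exists_measurableEmbedding_real X
  set e : X → ℝ := fun x => Real.arctan (e₀ x) with he
  have hem : Measurable e := Real.measurable_arctan.comp he₀.measurable
  have hei : Injective e := Real.arctan_injective.comp he₀.injective
  set L : X → ℝ := fun x => Filter.limsup (fun γ : Γ => e (γ • x)) Filter.cofinite with hL
  have hLm : Measurable L := by
    refine Measurable.limsup' (fun γ => hem.comp (measurable_const_smul γ))
      ⟨Filter.hasBasis_cofinite, ?_⟩ fun _ => to_countable _
    simpa using Set.countable_ofPred_finite_subset (countable_univ (α := Γ))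
  have hmap (δ : Γ) : Filter.map (· * δ) Filter.cofinite = (Filter.cofinite : Filter Γ) := by
    refine le_antisymm (mul_left_injective δ).tendsto_cofinite ?_
    have := Filter.map_mono (m := (· * δ)) (mul_left_injective δ⁻¹).tendsto_cofinite
    simpa [Filter.map_map, Function.comp_def] using this
  have hLinv (δ : Γ) (x : X) : L (δ • x) = L x := by
    simp only [hL, Filter.limsup]
    conv_rhs => rw [← hmap δ, Filter.map_map]
    simp only [Function.comp_def, mul_smul]
  refine ⟨fun x => ⌊1 / |e x - L x|⌋₊,
    Nat.measurable_floor.comp (((hem.sub hLm).norm).const_div 1), fun x n => ?_⟩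
  have hbdd : ∀ y, -(Real.pi / 2) ≤ e y ∧ e y ≤ Real.pi / 2 := fun y =>
    ⟨(Real.neg_pi_div_two_lt_arctan _).le, (Real.arctan_lt_pi_div_two _).le⟩
  set ε : ℝ := 1 / (n + 2) with hε
  have hεpos : 0 < ε := by positivity
  have h1 : ∃ᶠ γ : Γ in Filter.cofinite, L x - ε < e (γ • x) :=
    Filter.frequently_lt_of_lt_limsup
      (Filter.IsBoundedUnder.isCoboundedUnder_le ⟨-(Real.pi / 2),
        Filter.eventually_map.2 (.of_forall fun γ => (hbdd _).1)⟩) (by linarith : _ < L x)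
  have h2 : ∀ᶠ γ : Γ in Filter.cofinite, e (γ • x) < L x + ε :=
    Filter.eventually_lt_of_limsup_lt (by linarith : L x < _)
      ⟨Real.pi / 2, Filter.eventually_map.2 (.of_forall fun γ => (hbdd _).2)⟩
  have h3 : ∀ᶠ γ : Γ in Filter.cofinite, e (γ • x) ≠ L x := by
    refine Set.Subsingleton.finite fun γ hγ δ hδ => ?_
    simp only [mem_compl_iff, mem_setOf_eq, not_not] at hγ hδ
    have := hei (hγ.trans hδ.symm)
    have := hfree (δ⁻¹ * γ) x (by rw [mul_smul, this, inv_smul_smul])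
    rwa [inv_mul_eq_one, eq_comm] at this
  obtain ⟨γ, hγ1, hγ2, hγ3⟩ := (h1.and_eventually (h2.and h3)).exists
  refine ⟨γ, Nat.lt_of_succ_le (Nat.le_floor ?_)⟩
  rw [hLinv, le_div_iff₀ (abs_pos.2 (sub_ne_zero.2 hγ3))]
  have : |e (γ • x) - L x| ≤ ε := abs_le.2 ⟨by linarith, by linarith⟩
  calc ((n + 1 : ℕ) : ℝ) * |e (γ • x) - L x| ≤ (n + 2) * ε := by
        push_cast; gcongr; linarith
    _ = 1 := by rw [hε]; field_simp

/-! ### The pointer subshifts -/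

/-- A coding of colors: a color carries a rank, the rank of a target, and the group element that
leads to the target. -/
structure PointerCoding (Γ : Type*) where
  rank : ℕ → ℕ∞
  targetRank : ℕ → ℕ∞
  pointer : ℕ → Γ
  exists_color : ∀ a b γ, ∃ c, rank c = a ∧ targetRank c = b ∧ pointer c = γ

theorem nonempty_pointerCoding (Γ : Type*) [Countable Γ] [Nonempty Γ] :
    Nonempty (PointerCoding Γ) := by
  have : Countable ℕ∞ := inferInstanceAs (Countable (Option ℕ))
  obtain ⟨d, hd⟩ := exists_surjective_nat (ℕ∞ × ℕ∞ × Γ)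
  refine ⟨fun c => (d c).1, fun c => (d c).2.1, fun c => (d c).2.2, fun a b γ => ?_⟩
  obtain ⟨c, hc⟩ := hd (a, b, γ)
  exact ⟨c, by simp [hc]⟩

namespace PointerCoding

variable (P : PointerCoding Γ)

/-- Two colors are compatible, for the set `A` of allowed ranks, when the first one has rank `⊤`,
or it has an allowed rank which is below its target rank and the second one has this target rank. -/
def Compatible (A : Set ℕ∞) (c d : ℕ) : Prop :=
  P.rank c = ⊤ ∨ P.rank c ∈ A ∧ P.rank c < P.targetRank c ∧ P.rank d = P.targetRank c

variable [Group Γ]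

/-- The subshift of colorings in which every point of rank different from `⊤` has an allowed rank
and points to a point of larger rank, and at most one point has rank `⊤`. -/
def pointerShift (A : Set ℕ∞) : Set (Γ → ℕ) :=
  {ω | (∀ γ, P.Compatible A (ω γ) (ω (P.pointer (ω γ) * γ))) ∧
    ∀ γ δ, P.rank (ω γ) = ⊤ → P.rank (ω δ) = ⊤ → γ = δ}

variable {P} {A A' : Set ℕ∞}

theorem isSubshift_pointerShift : IsSubshift (P.pointerShift A) := by
  constructor
  · have hclosed (γ δ : Γ) (S : Set (ℕ × ℕ)) : IsClosed {ω : Γ → ℕ | (ω γ, ω δ) ∈ S} :=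
      (isClosed_discrete S).preimage (by fun_prop)
    have : P.pointerShift A =
        (⋂ (γ : Γ) (c : ℕ), {ω | (ω γ, ω (P.pointer c * γ)) ∈
          {p : ℕ × ℕ | p.1 = c → P.Compatible A c p.2}}) ∩
        ⋂ (γ : Γ) (δ : Γ), {ω | (ω γ, ω δ) ∈
          {p : ℕ × ℕ | P.rank p.1 = ⊤ → P.rank p.2 = ⊤ → γ = δ}} := by
      ext ω
      simp [pointerShift]
    rw [this]
    exact (isClosed_iInter fun γ => isClosed_iInter fun c => hclosed _ _ _).inter
      (isClosed_iInter fun γ => isClosed_iInter fun δ => hclosed _ _ _)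
  · rintro γ ω ⟨h1, h2⟩
    refine ⟨fun δ => ?_, fun δ η hδ hη => mul_right_cancel (h2 _ _ hδ hη)⟩
    simpa only [shift, mul_assoc] using h1 (δ * γ)

/-- If only finitely many ranks are allowed, then a point of rank `⊤` appears. -/
theorem exists_rank_eq_top (hA : A.Finite) {ω : Γ → ℕ} (hω : ω ∈ P.pointerShift A) :
    ∃ γ, P.rank (ω γ) = ⊤ := by
  by_contra! h
  have hfin : (range fun γ => P.rank (ω γ)).Finite := by
    refine hA.subset ?_
    rintro _ ⟨γ, rfl⟩
    exact ((hω.1 γ).resolve_left (h γ)).1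
  obtain ⟨_, ⟨γ, rfl⟩, hγ⟩ := Set.exists_max_image _ id hfin (range_nonempty _)
  obtain ⟨-, hlt, heq⟩ := (hω.1 γ).resolve_left (h γ)
  exact (hlt.trans_eq heq.symm).not_ge (hγ _ ⟨_, rfl⟩)

/-- Whether a finite partial coloring extends to a point of `P.pointerShift A` depends on the
membership in `A` of finitely many ranks only. -/
theorem mem_finOf_pointerShift_of_agree [Infinite Γ] {φ : FPC Γ}
    (hA' : (0 : ℕ∞) ∈ A')
    (hagree : ∀ γ c, φ.1 γ = some c → (P.rank c ∈ A → P.rank c ∈ A') ∧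
      (P.targetRank c ∈ A → P.targetRank c ∈ A'))
    (hφ : φ ∈ FinOf (P.pointerShift A)) : φ ∈ FinOf (P.pointerShift A') := by
  classical
  obtain ⟨ω, ⟨h1, h2⟩, hext⟩ := hφ
  have hcol : ∀ γ ∈ domP φ, φ.1 γ = some (ω γ) := by
    intro γ hγ
    obtain ⟨c, hc⟩ := Option.ne_none_iff_exists'.1 hγ
    rw [hc, hext γ c hc]
  set E : Set Γ := domP φ ∪
    (fun γ => P.pointer (ω γ) * γ) '' {γ ∈ domP φ | P.rank (ω γ) ≠ ⊤} with hE
  have hEfin : E.Finite := φ.2.union ((φ.2.subset (sep_subset _ _)).image _)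
  have hErank : ∀ γ ∈ E, P.rank (ω γ) ≠ ⊤ → P.rank (ω γ) ∈ A' := by
    rintro γ (hγ | ⟨δ, ⟨hδ, hδtop⟩, rfl⟩) htop
    · exact (hagree γ _ (hcol γ hγ)).1 ((h1 γ).resolve_left htop).1
    · have h := ((h1 δ).resolve_left hδtop).2.2
      have hmem := ((h1 _).resolve_left htop).1
      simp only [h] at hmem ⊢
      exact (hagree δ _ (hcol δ hδ)).2 hmem
  obtain ⟨z, hzE, hz⟩ : ∃ z, (z ∈ E → P.rank (ω z) = ⊤) ∧
      ∀ γ ∈ E, P.rank (ω γ) = ⊤ → γ = z := by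
    by_cases h : ∃ z ∈ E, P.rank (ω z) = ⊤
    · obtain ⟨z, -, hz⟩ := h
      exact ⟨z, fun _ => hz, fun γ _ hγ => h2 _ _ hγ hz⟩
    · obtain ⟨z, hz⟩ := hEfin.exists_notMem
      exact ⟨z, fun h => absurd h hz, fun γ hγ hγtop => absurd ⟨γ, hγ, hγtop⟩ h⟩
  choose col hcol_rank hcol_target hcol_pointer using P.exists_color
  set r : Γ → ℕ∞ := fun γ => if γ = z then ⊤ else if γ ∈ E then P.rank (ω γ) else 0 with hr
  have hrz : r z = ⊤ := if_pos rfl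
  have hrE : ∀ γ ∈ E, r γ = P.rank (ω γ) := by
    intro γ hγ
    by_cases hγz : γ = z
    · subst hγz
      rw [hrz, hzE hγ]
    · simp [hr, hγz, hγ]
  have hrA : ∀ γ, γ ≠ z → r γ ∈ A' ∧ r γ ≠ ⊤ := by
    intro γ hγz
    by_cases hγ : γ ∈ E
    · have htop : P.rank (ω γ) ≠ ⊤ := fun h => hγz (hz γ hγ h)
      rw [hrE γ hγ]
      exact ⟨hErank γ hγ htop, htop⟩
    · simp [hr, hγz, hγ, hA']
  set ω' : Γ → ℕ := fun γ => if γ ∈ domP φ then ω γ else col (r γ) ⊤ (z * γ⁻¹) with hω'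
  have hω'_dom : ∀ γ ∈ domP φ, ω' γ = ω γ := fun γ hγ => if_pos hγ
  have hω'_rank : ∀ γ, P.rank (ω' γ) = r γ := by
    intro γ
    by_cases hγ : γ ∈ domP φ
    · rw [hω'_dom γ hγ, hrE γ (.inl hγ)]
    · simp [hω', hγ, hcol_rank]
  have hω'_top : ∀ γ, P.rank (ω' γ) = ⊤ → γ = z := by
    intro γ hγ
    by_contra h
    exact (hrA γ h).2 (hω'_rank γ ▸ hγ)
  refine ⟨ω', ⟨fun γ => ?_, fun γ δ hγ hδ => (hω'_top γ hγ).trans (hω'_top δ hδ).symm⟩, ?_⟩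
  · refine or_iff_not_imp_left.2 fun htop => ?_
    have hγz : γ ≠ z := by
      rintro rfl
      exact htop ((hω'_rank _).trans hrz)
    refine ⟨hω'_rank γ ▸ (hrA γ hγz).1, ?_⟩
    by_cases hγ : γ ∈ domP φ
    · rw [hω'_dom γ hγ] at htop ⊢
      obtain ⟨-, hlt, heq⟩ := (h1 γ).resolve_left htop
      exact ⟨hlt, by rw [hω'_rank, hrE _ (.inr ⟨γ, ⟨hγ, htop⟩, rfl⟩), heq]⟩
    · have : ω' γ = col (r γ) ⊤ (z * γ⁻¹) := if_neg hγ
      rw [hω'_rank γ, this, hcol_target, hcol_pointer, inv_mul_cancel_right, hω'_rank z]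
      exact ⟨(hrA γ hγz).2.lt_top, hrz⟩
  · intro γ c hc
    have hγ : γ ∈ domP φ := by simp [domP, hc]
    rw [hω'_dom γ hγ]
    exact hext γ c hc

section Actions

variable {X : Type*} [TopologicalSpace X] [PolishSpace X] [MulAction Γ X]
  [ContinuousConstSMul Γ X] [Countable Γ]

theorem genSmooth_of_hasBMColoring_pointerShift (hA : A.Finite)
    (h : HasBMColoring X (P.pointerShift A)) : GenSmooth Γ X := by
  obtain ⟨f, hf, hC⟩ := h
  refine genSmooth_of_existsUnique_smul_mem (Γ := Γ) (T := f ⁻¹' {c | P.rank c = ⊤})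
    (baireMSet_iff_baireMeasurableSet.1 (hf _ trivial)) ?_
  filter_upwards [hC] with x hx
  obtain ⟨γ, hγ⟩ := exists_rank_eq_top hA hx
  exact ⟨γ, hγ, fun δ hδ => hx.2 _ _ hδ hγ⟩

theorem hasBMColoring_pointerShift [Infinite Γ] {S : Set ℕ} (hS : S.Infinite)
    (hfree : ∀ (γ : Γ) (x : X), γ • x = x → γ = 1) :
    HasBMColoring X (P.pointerShift ((↑) '' S)) := by
  classical
  borelize X
  obtain ⟨ρ, hρm, hρ⟩ := exists_measurable_unbounded_on_orbits (Γ := Γ) hfree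
  have := hS.to_subtype
  set r : X → ℕ := fun x => Nat.orderEmbeddingOfSet S (ρ x) with hr
  have hrm : Measurable r := (measurable_from_top (f := Nat.orderEmbeddingOfSet S)).comp hρm
  have hex : ∀ x, ∃ c, P.rank c = r x ∧ P.targetRank c = r (P.pointer c • x) ∧
      r x < r (P.pointer c • x) := by
    intro x
    obtain ⟨γ, hγ⟩ := hρ x (ρ x)
    obtain ⟨c, hc1, hc2, hc3⟩ := P.exists_color (r x) (r (γ • x)) γ
    refine ⟨c, hc1, by rw [hc2, hc3], ?_⟩
    rw [hc3]
    exact (Nat.orderEmbeddingOfSet S).lt_iff_lt.2 hγ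
  obtain ⟨f, hfm, hf⟩ : ∃ f : X → ℕ, Measurable f ∧ ∀ x, P.rank (f x) = r x ∧
      P.targetRank (f x) = r (P.pointer (f x) • x) ∧ r x < r (P.pointer (f x) • x) := by
    refine ⟨fun x => Nat.find (hex x), measurable_find hex fun c => ?_,
      fun x => Nat.find_spec (hex x)⟩
    have hpair := hrm.prodMk (hrm.comp (measurable_const_smul (P.pointer c)))
    exact hpair (MeasurableSet.of_discrete (s := {p : ℕ × ℕ | P.rank c = p.1 ∧
      P.targetRank c = p.2 ∧ p.1 < p.2}))
  refine ⟨f, hfm.baireMFun, Filter.Eventually.of_forall fun x => ⟨fun γ => .inr ?_, ?_⟩⟩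
  · obtain ⟨h1, h2, h3⟩ := hf (γ • x)
    simp only [codingMap, mul_smul, h1, h2, (hf _).1, Nat.cast_lt]
    exact ⟨⟨_, (Nat.Subtype.orderIsoOfNat S (ρ (γ • x))).2, rfl⟩, h3, trivial⟩
  · intro γ δ hγ
    exact absurd ((hf (γ • x)).1.symm.trans hγ) (ENat.natCast_ne_top _)

end Actions

end PointerCoding

/-! ### Hardness and easiness of the pointer subshifts -/

/-- The `MulAction` structure of a free Polish action. -/
abbrev FreePolishAction.mulAction [Group Γ] (α : FreePolishAction Γ) : MulAction Γ α.X where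
  smul := α.smul
  one_smul := α.one_smul'
  mul_smul := α.mul_smul'

theorem hard_pointerShift [Group Γ] [Countable Γ] {P : PointerCoding Γ} {A : Set ℕ∞}
    (hA : A.Finite) : Hard Γ (P.pointerShift A) := by
  intro α h
  let := α.ts
  have := α.polish
  let := α.mulAction
  have : ContinuousConstSMul Γ α.X := ⟨α.cont⟩
  exact PointerCoding.genSmooth_of_hasBMColoring_pointerShift (X := α.X) hA h

theorem easy_pointerShift [Group Γ] [Countable Γ] [Infinite Γ] {P : PointerCoding Γ} {S : Set ℕ}
    (hS : S.Infinite) : Easy Γ (P.pointerShift ((↑) '' S)) := by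
  intro α
  let := α.ts
  have := α.polish
  let := α.mulAction
  have : ContinuousConstSMul Γ α.X := ⟨α.cont⟩
  exact PointerCoding.hasBMColoring_pointerShift (X := α.X) hS α.free

/-! ### The parameter space -/

/-- The set of ranks allowed by a point of the Cantor space; the rank `0` is always allowed. -/
def allowedRanks (h : ℕ → Bool) : Set ℕ := {n | n = 0 ∨ h n = true}

theorem isOpen_setOf_finOf_pointerShift [Group Γ] [Infinite Γ] (P : PointerCoding Γ) (φ : FPC Γ)
    (p : Prop) :
    IsOpen {h : ℕ → Bool | φ ∈ FinOf (P.pointerShift ((↑) '' allowedRanks h)) ↔ p} := by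
  set M : Set ℕ := {n | ∃ γ ∈ domP φ, ∃ c ∈ φ.1 γ, P.rank c = n ∨ P.targetRank c = n} with hM
  have hMfin : M.Finite := by
    have : M ⊆ ⋃ γ ∈ domP φ, {((P.rank ((φ.1 γ).getD 0)).toNat),
        ((P.targetRank ((φ.1 γ).getD 0)).toNat)} := by
      rintro n ⟨γ, hγ, c, hc, h⟩
      refine mem_biUnion hγ ?_
      rw [Option.mem_def.1 hc]
      rcases h with h | h <;> simp [h]
    exact (φ.2.biUnion fun _ _ => toFinite _).subset this
  rw [isOpen_iff_mem_nhds]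
  intro h hh
  have hnear : ∀ᶠ h' in 𝓝 h, ∀ n ∈ M, h' n = h n :=
    (Filter.eventually_all_finite hMfin).2 fun n _ =>
      (continuous_apply n).continuousAt.eventually_mem ((isOpen_discrete {h n}).mem_nhds rfl)
  filter_upwards [hnear] with h' hh'
  refine Iff.trans ?_ hh
  have hrank (n : ℕ∞) (hn : n ∈ ((↑) '' M : Set ℕ∞)) :
      n ∈ ((↑) '' allowedRanks h' : Set ℕ∞) ↔ n ∈ ((↑) '' allowedRanks h : Set ℕ∞) := by
    obtain ⟨n, hn, rfl⟩ := hn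
    simp [allowedRanks, hh' n hn]
  have hzero (h : ℕ → Bool) : (0 : ℕ∞) ∈ ((↑) '' allowedRanks h : Set ℕ∞) :=
    ⟨0, .inl rfl, rfl⟩
  have hmem (γ : Γ) (c : ℕ) (hc : φ.1 γ = some c) (n : ℕ) (hn : P.rank c = n ∨ P.targetRank c = n) :
      (n : ℕ∞) ∈ ((↑) '' M : Set ℕ∞) :=
    ⟨n, ⟨γ, by simp [domP, hc], c, hc, hn⟩, rfl⟩
  constructor <;> refine PointerCoding.mem_finOf_pointerShift_of_agree (hzero _) fun γ c hc =>
    ⟨fun hn => ?_, fun hn => ?_⟩ <;> obtain ⟨n, -, hn'⟩ := id hn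
  · exact (hrank _ (hn' ▸ hmem γ c hc n (.inl hn'.symm))).1 hn
  · exact (hrank _ (hn' ▸ hmem γ c hc n (.inr hn'.symm))).1 hn
  · exact (hrank _ (hn' ▸ hmem γ c hc n (.inl hn'.symm))).2 hn
  · exact (hrank _ (hn' ▸ hmem γ c hc n (.inr hn'.symm))).2 hn

theorem finite_allowedRanks {h : ℕ → Bool} :
    (allowedRanks h).Finite ↔ {n | h n = true}.Finite := by
  simp [allowedRanks, ofPred_or]

theorem not_isOpen_singleton_cantor (h : ℕ → Bool) : ¬ IsOpen {h} := by
  intro hopen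
  have ht : Filter.Tendsto (fun N => update h N (!h N)) Filter.atTop (𝓝 h) := by
    refine tendsto_pi_nhds.2 fun n => tendsto_const_nhds.congr' ?_
    filter_upwards [Filter.eventually_gt_atTop n] with N hN
    rw [update_of_ne hN.ne]
  obtain ⟨N, hN⟩ := (ht.eventually_mem (hopen.mem_nhds rfl)).exists
  have := congrFun hN N
  simp at this

theorem dense_finite_support_cantor : Dense {h : ℕ → Bool | {n | h n = true}.Finite} := by
  intro h
  refine mem_closure_of_tendsto (f := fun N n => decide (n < N) && h n) (b := Filter.atTop)
    (tendsto_pi_nhds.2 fun n => tendsto_const_nhds.congr' ?_) (.of_forall fun N => ?_)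
  · filter_upwards [Filter.eventually_gt_atTop n] with N hN
    simp [hN]
  · exact (finite_lt_nat N).subset fun n hn => by simp_all

theorem countable_finite_support_cantor : {h : ℕ → Bool | {n | h n = true}.Finite}.Countable := by
  have hinj : Injective fun h : ℕ → Bool => {n | h n = true} := by
    intro h h' heq
    ext n
    exact Bool.eq_iff_iff.2 (Set.ext_iff.1 heq n)
  simpa using (countable_ofPred_finite_subset (countable_univ (α := ℕ))).preimage hinj

/-- There is a nonempty compact metrizable space `H` with no isolated points, a countable
dense subset `H₀`, and a continuous assignment of subshifts which are hard exactly on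
`H₀` and easy off `H₀`. -/
theorem stmt11 (Γ : Type*) [Group Γ] [Countable Γ] [Infinite Γ] :
    ∃ (H : Type) (tH : TopologicalSpace H) (H₀ : Set H) (Ωf : H → Set (Γ → ℕ)),
      Nonempty H ∧ @CompactSpace H tH ∧ @TopologicalSpace.MetrizableSpace H tH ∧
      (∀ h : H, ¬ @IsOpen H tH {h}) ∧
      H₀.Countable ∧ @Dense H tH H₀ ∧
      (∀ h : H, IsSubshift (Ωf h)) ∧
      (∀ φ : FPC Γ, @IsOpen H tH {h : H | φ ∈ FinOf (Ωf h)} ∧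
        @IsOpen H tH {h : H | φ ∉ FinOf (Ωf h)}) ∧
      (∀ h ∈ H₀, Hard Γ (Ωf h)) ∧
      (∀ h ∉ H₀, Easy Γ (Ωf h)) := by
  obtain ⟨P⟩ := nonempty_pointerCoding Γ
  refine ⟨ℕ → Bool, inferInstance, {h | {n | h n = true}.Finite},
    fun h => P.pointerShift ((↑) '' allowedRanks h), inferInstance, inferInstance, inferInstance,
    not_isOpen_singleton_cantor, countable_finite_support_cantor, dense_finite_support_cantor,
    fun h => PointerCoding.isSubshift_pointerShift, fun φ => ⟨?_, ?_⟩,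
    fun h hh => hard_pointerShift ((finite_allowedRanks.2 hh).image _),
    fun h hh => easy_pointerShift fun hfin => hh (finite_allowedRanks.1 hfin)⟩
  · simpa using isOpen_setOf_finOf_pointerShift P φ True
  · simpa using isOpen_setOf_finOf_pointerShift P φ False

end DescColor
end

section
/- Let Γ be a countably infinite group with a proper right-invariant metric d. For every subshift Ω ⊆ ℕ^Γ the following statements are equivalent: (i) the shift action of Γ on ℕ^Γ admits a Baire measurable Ω-coloring; (ii) there is a subshift Ω' ⊆ Ω with the join property; (iii) there are a local subshift Ω' and a map ρ : ℕ → ℕ such that ρ ∘ ω ∈ Ω for every ω ∈ Ω'. -/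
open Set Function Topology

namespace DescColor

variable {Γ : Type*}

/-- A closed set contains every coloring that it approximates on finite sets. -/
theorem mem_of_forall_finset {Ω : Set (Γ → ℕ)} (hΩ : IsClosed Ω) {ω : Γ → ℕ}
    (h : ∀ S : Finset Γ, ∃ ω' ∈ Ω, ∀ γ ∈ S, ω' γ = ω γ) : ω ∈ Ω := by
  rw [← hΩ.closure_eq, mem_closure_iff]
  intro o ho hω
  obtain ⟨I, u, h1, h2⟩ := isOpen_pi_iff.1 ho ω hω
  obtain ⟨ω', hω', hag⟩ := h I
  refine ⟨ω', h2 fun i hi => ?_, hω'⟩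
  rw [hag i hi]
  exact (h1 i hi).2

theorem exists_finset_cylinder {U : Set (Γ → ℕ)} (hU : IsOpen U) {x : Γ → ℕ} (hx : x ∈ U) :
    ∃ S : Finset Γ, ∀ y : Γ → ℕ, (∀ γ ∈ S, y γ = x γ) → y ∈ U := by
  obtain ⟨I, u, h1, h2⟩ := isOpen_pi_iff.1 hU x hx
  refine ⟨I, fun y hy => h2 fun i hi => ?_⟩
  rw [hy i hi]
  exact (h1 i hi).2

theorem isClopen_eval_eq (γ : Γ) (c : ℕ) : IsClopen {x : Γ → ℕ | x γ = c} :=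
  (isClopen_discrete {c}).preimage (continuous_apply γ)

theorem joinP_of_left {φ ψ : FPC Γ} {δ : Γ} {c : ℕ} (h : φ.1 δ = some c) :
    (joinP φ ψ).1 δ = some c := by
  simp [joinP, h]

theorem joinP_of_none {φ ψ : FPC Γ} {δ : Γ} (h : φ.1 δ = none) :
    (joinP φ ψ).1 δ = ψ.1 δ := by
  simp [joinP, h]

theorem exists_mem_of_joinList {l : List (FPC Γ)} {δ : Γ} {c : ℕ}
    (h : (joinList l).1 δ = some c) : ∃ φ ∈ l, φ.1 δ = some c := by
  induction l with
  | nil => simp [joinList, emptyP] at h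
  | cons φ l ih =>
    cases hφ : φ.1 δ with
    | some c' =>
      have := (joinP_of_left (ψ := joinList l) hφ).symm.trans h
      exact ⟨φ, by simp, by rw [hφ, this]⟩
    | none =>
      obtain ⟨ψ, hψ, h'⟩ := ih ((joinP_of_none (ψ := joinList l) hφ).symm.trans h)
      exact ⟨ψ, by simp [hψ], h'⟩

theorem joinList_apply_of_mem [MetricSpace Γ] {R : FPC Γ → ℝ} (hR : ∀ φ, 0 ≤ R φ)
    {l : List (FPC Γ)} (hl : l.Pairwise (RSeparated R)) {φ : FPC Γ} (hφ : φ ∈ l) {δ : Γ} {c : ℕ}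
    (h : φ.1 δ = some c) : (joinList l).1 δ = some c := by
  induction l with
  | nil => simp at hφ
  | cons ψ l ih =>
    rw [List.pairwise_cons] at hl
    rcases List.mem_cons.1 hφ with rfl | hφ
    · exact joinP_of_left h
    · have : ψ.1 δ = none := by
        by_contra hne
        have := hl.1 φ hφ δ hne δ (by simp [domP, h])
        rw [dist_self] at this
        linarith [hR ψ, hR φ]
      exact (joinP_of_none this).trans (ih hl.2 hφ)

theorem finOf_restrict {Ω : Set (Γ → ℕ)} [DecidableEq Γ] {ω : Γ → ℕ} (hω : ω ∈ Ω)
    (S : Finset Γ) : restrictTo ω S ∈ FinOf Ω := by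
  refine ⟨ω, hω, fun γ c h => ?_⟩
  simp only [restrictTo] at h
  split_ifs at h
  exact Option.some.inj h

theorem shiftP_mem_finOf [Group Γ] {Ω : Set (Γ → ℕ)} (hΩ : IsSubshift Ω) (γ : Γ) {φ : FPC Γ}
    (hφ : φ ∈ FinOf Ω) : shiftP γ φ ∈ FinOf Ω := by
  obtain ⟨ω, hω, h⟩ := hφ
  exact ⟨shift γ ω, hΩ.2 γ ω hω, fun δ c hc => h _ _ hc⟩

theorem continuous_shift [Group Γ] (γ : Γ) : Continuous (shift γ) :=
  continuous_pi fun _ => continuous_apply _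

theorem shift_shift [Group Γ] (γ δ : Γ) (ω : Γ → ℕ) :
    shift γ (shift δ ω) = shift (γ * δ) ω := by
  funext ε
  simp [shift, mul_assoc]

theorem shift_one [Group Γ] (ω : Γ → ℕ) : shift 1 ω = ω := by
  funext ε
  simp [shift]

/-- The shift by a group element as a homeomorphism. -/
def shiftHomeo [Group Γ] (γ : Γ) : (Γ → ℕ) ≃ₜ (Γ → ℕ) where
  toFun := shift γ
  invFun := shift γ⁻¹
  left_inv ω := by simp [shift_shift, shift_one]
  right_inv ω := by simp [shift_shift, shift_one]
  continuous_toFun := continuous_shift γ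
  continuous_invFun := continuous_shift γ⁻¹

theorem shift_preimage_mem_residual [Group Γ] (γ : Γ) {S : Set (Γ → ℕ)}
    (hS : S ∈ residual (Γ → ℕ)) : {x | shift γ x ∈ S} ∈ residual (Γ → ℕ) := by
  have h := IsMeagre.preimage_of_isOpenMap (continuous_shift γ) (shiftHomeo γ).isOpenMap
    (s := Sᶜ) (by rwa [IsMeagre, compl_compl])
  rwa [IsMeagre, ← preimage_compl, compl_compl] at h

instance fpc_countable [Countable Γ] : Countable (FPC Γ) := by
  classical
  refine Function.Injective.countable
    (f := fun φ : FPC Γ => (φ.2.toFinset.image fun γ => (γ, φ.1 γ))) ?_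
  intro φ ψ h
  dsimp only at h
  apply Subtype.ext
  funext γ
  have key : ∀ φ : FPC Γ, ∀ o : Option ℕ, o ≠ none →
      ((γ, o) ∈ (φ.2.toFinset.image fun γ => (γ, φ.1 γ)) ↔ φ.1 γ = o) := by
    intro φ o ho
    simp only [Finset.mem_image, Finite.mem_toFinset, mem_ofPred_eq, Prod.mk.injEq]
    constructor
    · rintro ⟨a, -, rfl, h⟩
      exact h
    · intro h
      exact ⟨γ, by rwa [h], rfl, h⟩
  by_cases hφ : φ.1 γ = none
  · by_contra hne
    have hψ : ψ.1 γ ≠ none := fun h => hne (hφ.trans h.symm)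
    have := (key φ (ψ.1 γ) hψ).1 (by
      have h2 := (key ψ (ψ.1 γ) hψ).2 rfl
      exact h ▸ h2)
    exact hne this
  · have h2 := (key φ (φ.1 γ) hφ).2 rfl
    exact ((key ψ (φ.1 γ) hφ).1 (h ▸ h2)).symm

theorem RSeparated.symm [MetricSpace Γ] {R : FPC Γ → ℝ} {φ ψ : FPC Γ}
    (h : RSeparated R φ ψ) : RSeparated R ψ φ :=
  fun γ hγ δ hδ => by
    rw [dist_comm, add_comm]
    exact h δ hδ γ hγ

/-- The translate of `φ` based at `γ`. -/
def place [Group Γ] (φ : FPC Γ) (γ : Γ) : FPC Γ := shiftP γ⁻¹ φ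

theorem place_mul_apply [Group Γ] (φ : FPC Γ) (γ g δ : Γ) :
    (place φ (γ * g)).1 (δ * g) = (place φ γ).1 δ := by
  simp [place, shiftP, mul_assoc]

theorem isRestrictionOf_place_mul [Group Γ] (φ ψ : FPC Γ) (γ γ' g : Γ) :
    IsRestrictionOf (place φ (γ * g)) (place ψ (γ' * g)) ↔
      IsRestrictionOf (place φ γ) (place ψ γ') := by
  constructor
  · intro h δ
    have := h (δ * g)
    rwa [place_mul_apply, place_mul_apply] at this
  · intro h δ
    have := h (δ * g⁻¹)
    rwa [← place_mul_apply φ _ g, ← place_mul_apply ψ _ g, inv_mul_cancel_right] at this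

section JoinColoring

variable [Group Γ] [MetricSpace Γ] (Φ : ℕ → FPC Γ) (R : FPC Γ → ℝ)

/-- Each `γ` proposes the pattern `Φ (x γ)`, placed at `γ`. A proposal is accepted if it is
separated from every other proposal of at most the same index, except for those of smaller
index that are either rejected or extended by it. -/
def Accepted (x : Γ → ℕ) (γ : Γ) : Prop :=
  ∀ γ' : Γ, γ' ≠ γ → x γ' ≤ x γ →
    RSeparated R (place (Φ (x γ)) γ) (place (Φ (x γ')) γ') ∨
      ∃ _ : x γ' < x γ, Accepted x γ' →
        IsRestrictionOf (place (Φ (x γ')) γ') (place (Φ (x γ)) γ)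
termination_by x γ

/-- The union of all accepted patterns assigns the color `c` to `δ`. -/
def Assigns (x : Γ → ℕ) (δ : Γ) (c : ℕ) : Prop :=
  ∃ γ : Γ, Accepted Φ R x γ ∧ (place (Φ (x γ)) γ).1 δ = some c

variable {Φ R}

theorem rSeparated_place_mul (hinv : ∀ γ δ g : Γ, dist (γ * g) (δ * g) = dist γ δ)
    (hR : ∀ n γ, R (place (Φ n) γ) = R (Φ n)) (m n : ℕ) (γ γ' g : Γ) :
    RSeparated R (place (Φ m) (γ * g)) (place (Φ n) (γ' * g)) ↔
      RSeparated R (place (Φ m) γ) (place (Φ n) γ') := by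
  simp only [RSeparated, hR, domP, mem_ofPred_eq]
  constructor
  · intro h a ha b hb
    have := h (a * g) (by rwa [place_mul_apply]) (b * g) (by rwa [place_mul_apply])
    rwa [hinv] at this
  · intro h a ha b hb
    have := h (a * g⁻¹) (by rwa [← place_mul_apply _ _ g, inv_mul_cancel_right])
      (b * g⁻¹) (by rwa [← place_mul_apply _ _ g, inv_mul_cancel_right])
    rwa [hinv] at this

theorem accepted_shift (hinv : ∀ γ δ g : Γ, dist (γ * g) (δ * g) = dist γ δ)
    (hR : ∀ n γ, R (place (Φ n) γ) = R (Φ n)) (x : Γ → ℕ) (g γ : Γ) :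
    Accepted Φ R (shift g x) γ ↔ Accepted Φ R x (γ * g) := by
  induction hn : x (γ * g) using Nat.strong_induction_on generalizing γ with
  | _ n ih =>
    subst hn
    rw [Accepted, Accepted]
    refine Iff.trans (forall_congr' fun γ' => ?_) (Equiv.mulRight g).forall_congr_right
    simp only [shift, Equiv.coe_mulRight, ne_eq, mul_left_inj, rSeparated_place_mul hinv hR,
      isRestrictionOf_place_mul]
    refine imp_congr_right fun _ => imp_congr_right fun _ => or_congr_right ?_
    refine exists_congr fun hlt => ?_
    rw [← ih _ hlt γ' rfl]

theorem assigns_shift (hinv : ∀ γ δ g : Γ, dist (γ * g) (δ * g) = dist γ δ)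
    (hR : ∀ n γ, R (place (Φ n) γ) = R (Φ n)) (x : Γ → ℕ) (g δ : Γ) (c : ℕ) :
    Assigns Φ R (shift g x) δ c ↔ Assigns Φ R x (δ * g) c := by
  rw [Assigns, Assigns]
  refine Iff.trans (exists_congr fun γ => ?_) (Equiv.mulRight g).exists_congr_right
  rw [accepted_shift hinv hR, Equiv.coe_mulRight, place_mul_apply]
  rfl

theorem finite_not_rSeparated (hproper : ∀ (γ : Γ) (r : ℝ), (Metric.closedBall γ r).Finite)
    (hR : ∀ n γ, R (place (Φ n) γ) = R (Φ n)) (φ : FPC Γ) (n : ℕ) :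
    {γ' : Γ | ¬ RSeparated R φ (place (Φ n) γ')}.Finite := by
  have hfin : (⋃ a ∈ domP φ, image2 (fun e b : Γ => e⁻¹ * b) (domP (Φ n))
      (Metric.closedBall a (R φ + R (Φ n)))).Finite :=
    φ.2.biUnion fun a _ => (Φ n).2.image2 _ (hproper _ _)
  refine hfin.subset fun γ' h => ?_
  simp only [mem_ofPred_eq, RSeparated, hR, not_forall, not_lt] at h
  obtain ⟨a, ha, b, hb, hab⟩ := h
  simp only [mem_iUnion]
  refine ⟨a, ha, b * γ'⁻¹, hb, b, ?_, by simp⟩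
  rwa [Metric.mem_closedBall, dist_comm]

theorem isClopen_accepted (hproper : ∀ (γ : Γ) (r : ℝ), (Metric.closedBall γ r).Finite)
    (hR : ∀ n γ, R (place (Φ n) γ) = R (Φ n)) (n : ℕ) (γ : Γ) :
    IsClopen {x : Γ → ℕ | x γ = n ∧ Accepted Φ R x γ} := by
  induction n using Nat.strong_induction_on generalizing γ with
  | _ n ih =>
    have heq : {x : Γ → ℕ | x γ = n ∧ Accepted Φ R x γ} = {x | x γ = n} ∩
        ⋂ m ∈ Iic n, ⋂ γ' ∈ {γ' | γ' ≠ γ ∧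
          ¬ RSeparated R (place (Φ n) γ) (place (Φ m) γ')},
        {x : Γ → ℕ | x γ' = m → m < n ∧ (Accepted Φ R x γ' →
          IsRestrictionOf (place (Φ m) γ') (place (Φ n) γ))} := by
      ext x
      simp only [mem_ofPred_eq, mem_inter_iff, mem_iInter, mem_Iic]
      refine and_congr_right fun hx => ?_
      subst hx
      rw [Accepted]
      constructor
      · rintro h m hm γ' ⟨hne, hs⟩ rfl
        obtain ⟨h1, h2⟩ := (h γ' hne hm).resolve_left hs
        exact ⟨h1, h2⟩
      · intro h γ' hne hle
        by_cases hs : RSeparated R (place (Φ (x γ)) γ) (place (Φ (x γ')) γ')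
        · exact Or.inl hs
        · obtain ⟨h1, h2⟩ := h _ hle γ' ⟨hne, hs⟩ rfl
          exact Or.inr ⟨h1, h2⟩
    rw [heq]
    refine (isClopen_eval_eq γ n).inter ((finite_Iic n).isClopen_biInter fun m _ => ?_)
    refine Finite.isClopen_biInter ((finite_not_rSeparated hproper hR _ m).subset
      fun γ' h => h.2) fun γ' _ => ?_
    by_cases hlt : m < n
    · by_cases hres : IsRestrictionOf (place (Φ m) γ') (place (Φ n) γ)
      · simp [hlt, hres, isClopen_univ]
      · convert (ih m hlt γ').compl using 1
        ext x
        simp [hlt, hres]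
    · convert (isClopen_eval_eq γ' m).compl using 1
      ext x
      simp [hlt]

theorem isOpen_assigns (hproper : ∀ (γ : Γ) (r : ℝ), (Metric.closedBall γ r).Finite)
    (hR : ∀ n γ, R (place (Φ n) γ) = R (Φ n)) (δ : Γ) (c : ℕ) :
    IsOpen {x : Γ → ℕ | Assigns Φ R x δ c} := by
  have heq : {x : Γ → ℕ | Assigns Φ R x δ c} =
      ⋃ γ, ⋃ n, ⋃ _ : (place (Φ n) γ).1 δ = some c, {x | x γ = n ∧ Accepted Φ R x γ} := by
    ext x
    simp only [Assigns, mem_ofPred_eq, mem_iUnion]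
    constructor
    · rintro ⟨γ, h1, h2⟩
      exact ⟨γ, x γ, h2, rfl, h1⟩
    · rintro ⟨γ, n, h2, rfl, h1⟩
      exact ⟨γ, h1, h2⟩
  rw [heq]
  exact isOpen_iUnion fun γ => isOpen_iUnion fun n => isOpen_iUnion fun _ =>
    (isClopen_accepted hproper hR n γ).isOpen

/-- Finitely many accepted patterns have a common extension. -/
theorem exists_extension_accepted {P : Set (FPC Γ)} (hR0 : ∀ φ, 0 ≤ R φ)
    (hjoin : ∀ l : List (FPC Γ), (∀ φ ∈ l, φ ∈ P) → l.Pairwise (RSeparated R) → joinList l ∈ P)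
    (hP : ∀ n γ, place (Φ n) γ ∈ P) (x : Γ → ℕ) (T : Finset Γ)
    (hT : ∀ γ ∈ T, Accepted Φ R x γ) :
    ∃ ψ ∈ P, ∀ γ ∈ T, ∀ (δ : Γ) (c : ℕ), (place (Φ (x γ)) γ).1 δ = some c →
      ψ.1 δ = some c := by
  classical
  let T' := T.filter fun γ => ∀ γ' ∈ T, x γ < x γ' →
    ¬ IsRestrictionOf (place (Φ (x γ)) γ) (place (Φ (x γ')) γ')
  let l := T'.toList.map fun γ => place (Φ (x γ)) γ
  have hsep : ∀ γ ∈ T', ∀ γ' ∈ T', γ' ≠ γ → x γ' ≤ x γ →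
      RSeparated R (place (Φ (x γ)) γ) (place (Φ (x γ')) γ') := by
    intro γ hγ γ' hγ' hne hle
    rw [Finset.mem_filter] at hγ hγ'
    have h := hT γ hγ.1
    rw [Accepted] at h
    rcases h γ' hne hle with h | ⟨hlt, h⟩
    · exact h
    · exact absurd (h (hT γ' hγ'.1)) (hγ'.2 γ hγ.1 hlt)
  have hl : l.Pairwise (RSeparated R) := by
    rw [List.pairwise_map]
    refine T'.nodup_toList.imp_of_mem fun {γ γ'} hγ hγ' hne => ?_
    rw [Finset.mem_toList] at hγ hγ'
    rcases le_total (x γ') (x γ) with hle | hle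
    · exact hsep γ hγ γ' hγ' (Ne.symm hne) hle
    · exact (hsep γ' hγ' γ hγ hne hle).symm
  refine ⟨joinList l, hjoin l ?_ hl, ?_⟩
  · intro φ hφ
    obtain ⟨γ, -, rfl⟩ := List.mem_map.1 hφ
    exact hP _ _
  · intro γ hγ δ c hc
    obtain ⟨γ', hγ', hmax⟩ := (T.filter fun γ' => IsRestrictionOf (place (Φ (x γ)) γ)
      (place (Φ (x γ')) γ')).exists_max_image x ⟨γ, Finset.mem_filter.2 ⟨hγ, fun _ => Or.inr rfl⟩⟩
    rw [Finset.mem_filter] at hγ'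
    have hγT : γ' ∈ T' := by
      refine Finset.mem_filter.2 ⟨hγ'.1, fun γ'' h'' hlt hres => ?_⟩
      refine absurd hlt (not_lt.2 (hmax γ'' (Finset.mem_filter.2 ⟨h'', fun ε => ?_⟩)))
      rcases hγ'.2 ε with h | h
      · exact Or.inl h
      · rw [h]
        exact hres ε
    refine joinList_apply_of_mem hR0 hl (List.mem_map_of_mem (Finset.mem_toList.2 hγT)) ?_
    rcases hγ'.2 δ with h | h
    · simp [h] at hc
    · rw [← h, hc]

theorem Assigns.unique {P : Set (FPC Γ)} (hR0 : ∀ φ, 0 ≤ R φ)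
    (hjoin : ∀ l : List (FPC Γ), (∀ φ ∈ l, φ ∈ P) → l.Pairwise (RSeparated R) → joinList l ∈ P)
    (hP : ∀ n γ, place (Φ n) γ ∈ P) {x : Γ → ℕ} {δ : Γ} {c c' : ℕ}
    (h : Assigns Φ R x δ c) (h' : Assigns Φ R x δ c') : c = c' := by
  classical
  obtain ⟨γ, h1, h2⟩ := h
  obtain ⟨γ', h1', h2'⟩ := h'
  obtain ⟨ψ, -, hψ⟩ := exists_extension_accepted hR0 hjoin hP x {γ, γ'} (by
    simp [h1, h1'])
  exact Option.some.inj ((hψ γ (by simp) δ c h2).symm.trans (hψ γ' (by simp) δ c' h2'))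

theorem dense_assigns [Infinite Γ]
    (hproper : ∀ (γ : Γ) (r : ℝ), (Metric.closedBall γ r).Finite)
    {Ω : Set (Γ → ℕ)} (hΩ : IsSubshift Ω) (hR0 : ∀ φ, 0 ≤ R φ)
    (hjoin : ∀ l : List (FPC Γ), (∀ φ ∈ l, φ ∈ FinOf Ω) → l.Pairwise (RSeparated R) →
      joinList l ∈ FinOf Ω)
    (hP : ∀ n γ, place (Φ n) γ ∈ FinOf Ω)
    (hR : ∀ n γ, R (place (Φ n) γ) = R (Φ n))
    (hΦ : ∀ φ ∈ FinOf Ω, ∀ m, ∃ n ≥ m, Φ n = φ) (δ : Γ) :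
    Dense {x : Γ → ℕ | ∃ c, Assigns Φ R x δ c} := by
  classical
  rw [dense_iff_inter_open]
  rintro O hO ⟨y, hy⟩
  obtain ⟨F, hF⟩ := exists_finset_cylinder hO hy
  obtain ⟨n₀, -, hn₀⟩ := hΦ (emptyP Γ) (hjoin [] (by simp) (by simp)) 0
  let x₀ : Γ → ℕ := fun γ => if γ ∈ F then y γ else n₀
  let V : Set (Γ → ℕ) := ⋂ γ ∈ (F.filter fun γ => ¬ Accepted Φ R x₀ γ),
    {x : Γ → ℕ | x γ = x₀ γ ∧ Accepted Φ R x γ}ᶜ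
  have hV : IsOpen V := isOpen_biInter_finset fun γ _ =>
    (isClopen_accepted hproper hR _ γ).compl.isOpen
  have hx₀V : x₀ ∈ V := by
    simp only [V, mem_iInter, Finset.mem_filter]
    rintro γ ⟨-, h⟩ ⟨-, h'⟩
    exact h h'
  obtain ⟨F', hF'⟩ := exists_finset_cylinder hV hx₀V
  obtain ⟨γ₀, hγ₀⟩ := Infinite.exists_notMem_finset (F ∪ F')
  rw [Finset.mem_union, not_or] at hγ₀
  obtain ⟨ψ, ⟨ω, hω, hψω⟩, hψ⟩ := exists_extension_accepted hR0 hjoin hP x₀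
    (F.filter fun γ => Accepted Φ R x₀ γ) (by simp)
  let φ := restrictTo ω (insert δ ψ.2.toFinset)
  have hφ : φ ∈ FinOf Ω := finOf_restrict hω _
  obtain ⟨n, hn, hnφ⟩ := hΦ (shiftP γ₀ φ) (shiftP_mem_finOf hΩ _ hφ) (F.sup x₀ + 1)
  have hplace : place (Φ n) γ₀ = φ := by
    rw [hnφ]
    apply Subtype.ext
    funext ε
    simp [place, shiftP]
  let x₁ := update x₀ γ₀ n
  have hx₁ : ∀ γ, γ ≠ γ₀ → x₁ γ = x₀ γ := fun γ h => update_of_ne h _ _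
  have hx₁γ₀ : x₁ γ₀ = n := update_self _ _ _
  have hx₁V : x₁ ∈ V := hF' x₁ fun γ hγ => hx₁ γ (by rintro rfl; exact hγ₀.2 hγ)
  have hacc : Accepted Φ R x₁ γ₀ := by
    rw [Accepted]
    intro γ hne _
    rw [hx₁ γ hne, hx₁γ₀, hplace]
    by_cases hγ : γ ∈ F
    · refine Or.inr ⟨lt_of_lt_of_le (Nat.lt_succ_of_le (Finset.le_sup hγ)) hn, fun h => ?_⟩
      have h0 : Accepted Φ R x₀ γ := by
        by_contra h0
        simp only [V, mem_iInter] at hx₁V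
        exact hx₁V γ (Finset.mem_filter.2 ⟨hγ, h0⟩) ⟨hx₁ γ hne, h⟩
      intro ε
      cases hε : (place (Φ (x₀ γ)) γ).1 ε with
      | none => exact Or.inl rfl
      | some c =>
        have h1 := hψ γ (Finset.mem_filter.2 ⟨hγ, h0⟩) ε c hε
        right
        simp [φ, restrictTo, h1, hψω ε c h1]
    · left
      intro a _ b hb
      simp [domP, x₀, hγ, hn₀, place, shiftP, emptyP] at hb
  refine ⟨x₁, hF _ fun γ hγ => ?_, ω δ, γ₀, hacc, ?_⟩
  · rw [hx₁ γ (by rintro rfl; exact hγ₀.1 hγ)]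
    simp [x₀, hγ]
  · rw [hx₁γ₀, hplace]
    simp [φ, restrictTo]

end JoinColoring

theorem HasJoinProperty.shiftHasBMColoring [Group Γ] [Countable Γ] [Infinite Γ] [MetricSpace Γ]
    (hinv : ∀ γ δ g : Γ, dist (γ * g) (δ * g) = dist γ δ)
    (hproper : ∀ (γ : Γ) (r : ℝ), (Metric.closedBall γ r).Finite)
    {Ω : Set (Γ → ℕ)} (hΩ : IsSubshift Ω) (h : HasJoinProperty (FinOf Ω)) :
    ShiftHasBMColoring Γ Ω := by
  classical
  obtain ⟨R, hR0, hRinv, hjoin⟩ := h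
  have : Nonempty (FinOf Ω) := ⟨⟨_, hjoin [] (by simp) (by simp)⟩⟩
  obtain ⟨e, he⟩ := exists_surjective_nat (FinOf Ω)
  let Φ : ℕ → FPC Γ := fun n => (e n.unpair.1).1
  have hΦ : ∀ φ ∈ FinOf Ω, ∀ m, ∃ n ≥ m, Φ n = φ := by
    intro φ hφ m
    obtain ⟨k, hk⟩ := he ⟨φ, hφ⟩
    exact ⟨Nat.pair k m, Nat.right_le_pair k m, by simp [Φ, hk]⟩
  have hP : ∀ n γ, place (Φ n) γ ∈ FinOf Ω := fun n γ => shiftP_mem_finOf hΩ _ (e _).2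
  have hR : ∀ n γ, R (place (Φ n) γ) = R (Φ n) := fun n γ => hRinv _ _ (e _).2
  let D : Γ → Set (Γ → ℕ) := fun δ => {x | ∃ c, Assigns Φ R x δ c}
  have hDopen : ∀ δ, IsOpen (D δ) := fun δ => by
    simp only [D, ofPred_exists]
    exact isOpen_iUnion fun c => isOpen_assigns hproper hR δ c
  have hD : ∀ δ, D δ ∈ residual (Γ → ℕ) := fun δ =>
    residual_of_dense_open (hDopen δ) (dense_assigns hproper hΩ hR0 hjoin hP hR hΦ δ)
  let f : (Γ → ℕ) → ℕ := fun x => if h : ∃ c, Assigns Φ R x 1 c then h.choose else 0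
  have hf : ∀ x c, Assigns Φ R x 1 c → f x = c := by
    intro x c h
    have hx : ∃ c, Assigns Φ R x 1 c := ⟨c, h⟩
    simp only [f, dif_pos hx]
    exact hx.choose_spec.unique hR0 hjoin hP h
  refine ⟨f, fun B _ => ⟨⋃ c ∈ B, {x | Assigns Φ R x 1 c},
    isOpen_biUnion fun c _ => isOpen_assigns hproper hR 1 c, ?_⟩, ?_⟩
  · refine Filter.mem_of_superset (hD 1) ?_
    rintro x ⟨c, hc⟩
    have hmem : x ∈ (⋃ c ∈ B, {x | Assigns Φ R x 1 c}) ↔ x ∈ f ⁻¹' B := by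
      simp only [mem_iUnion, mem_ofPred_eq, mem_preimage, hf x c hc]
      constructor
      · rintro ⟨c', hB, hc'⟩
        rwa [hc.unique hR0 hjoin hP hc']
      · exact fun hB => ⟨c, hB, hc⟩
    rw [mem_compl_iff, mem_symmDiff, hmem]
    tauto
  · refine Filter.mem_of_superset (countable_iInter_mem.2 hD) fun x hx => ?_
    simp only [mem_iInter] at hx
    choose c hc using hx
    have hfc : ∀ γ, f (shift γ x) = c γ := fun γ =>
      hf _ _ ((assigns_shift hinv hR x γ 1 _).2 (by rw [one_mul]; exact hc γ))
    refine mem_of_forall_finset hΩ.1 fun S => ?_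
    choose p hp hpc using hc
    obtain ⟨ψ, ⟨ω, hω, hψω⟩, hψ⟩ := exists_extension_accepted hR0 hjoin hP x (S.image p) (by
      simp only [Finset.mem_image]
      rintro _ ⟨γ, -, rfl⟩
      exact hp γ)
    refine ⟨ω, hω, fun γ hγ => ?_⟩
    rw [hfc]
    exact hψω _ _ (hψ _ (Finset.mem_image_of_mem p hγ) _ _ (hpc γ))

section PatchSubshift

/-- The colorings extending a given finite partial coloring. -/
def cyl (φ : FPC Γ) : Set (Γ → ℕ) := {x | ∀ (γ : Γ) (c : ℕ), φ.1 γ = some c → x γ = c}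

theorem isOpen_cyl (φ : FPC Γ) : IsOpen (cyl φ) := by
  have heq : cyl φ = ⋂ γ ∈ domP φ, {x | φ.1 γ = some (x γ)} := by
    ext x
    simp only [cyl, domP, mem_ofPred_eq, mem_iInter]
    constructor
    · intro h γ hγ
      obtain ⟨c, hc⟩ := Option.ne_none_iff_exists'.1 hγ
      rw [hc, h γ c hc]
    · intro h γ c hc
      have := h γ (by simp [hc])
      rw [hc] at this
      exact (Option.some.inj this).symm
  rw [heq]
  refine Finite.isOpen_biInter φ.2 fun γ _ => ?_
  have hopen : IsOpen ((fun x : Γ → ℕ => x γ) ⁻¹' {n : ℕ | φ.1 γ = some n}) :=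
    (isOpen_discrete _).preimage (continuous_apply γ)
  exact hopen

variable [Group Γ]

theorem mem_cyl_place {φ : FPC Γ} {γ : Γ} {x : Γ → ℕ} :
    x ∈ cyl (place φ γ) ↔ shift γ x ∈ cyl φ := by
  constructor
  · intro h δ c hc
    exact h (δ * γ) c (by simpa [place, shiftP] using hc)
  · intro h δ c hc
    simpa [shift] using h (δ * γ⁻¹) c hc

/-- The patterns `ψ m` placed at `γ` and `ψ n` placed at `γ'` agree on their common domain. -/
def Compatible (ψ : ℕ → FPC Γ) (γ γ' : Γ) (m n : ℕ) : Prop :=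
  ∀ (δ : Γ) (c c' : ℕ), (place (ψ m) γ).1 δ = some c → (place (ψ n) γ').1 δ = some c' → c = c'

/-- The colorings `ω` for which the patterns `ψ (ω γ)` placed at `γ` are pairwise compatible. -/
def patchSubshift (ψ : ℕ → FPC Γ) : Set (Γ → ℕ) :=
  {ω | ∀ γ γ' : Γ, Compatible ψ γ γ' (ω γ) (ω γ')}

variable {ψ : ℕ → FPC Γ}

theorem isSubshift_patchSubshift : IsSubshift (patchSubshift ψ) := by
  constructor
  · simp only [patchSubshift, ofPred_forall]
    refine isClosed_iInter fun γ => isClosed_iInter fun γ' => ?_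
    have hclosed : IsClosed ((fun ω : Γ → ℕ => (ω γ, ω γ')) ⁻¹'
        {p : ℕ × ℕ | Compatible ψ γ γ' p.1 p.2}) :=
      (isClosed_discrete _).preimage ((continuous_apply γ).prodMk (continuous_apply γ'))
    exact hclosed
  · intro g ω hω γ γ' δ c c' h h'
    refine hω (γ * g) (γ' * g) (δ * g) c c' ?_ ?_
    · rwa [place_mul_apply]
    · rwa [place_mul_apply]

theorem exists_mem_cyl_of_compatible [Countable Γ] {φ : FPC Γ}
    (hφ : ∀ γ γ' m n, φ.1 γ = some m → φ.1 γ' = some n → Compatible ψ γ γ' m n)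
    {G : Set (Γ → ℕ)} (hG : G ∈ residual (Γ → ℕ)) :
    ∃ x ∈ G, ∀ γ m, φ.1 γ = some m → x ∈ cyl (place (ψ m) γ) := by
  classical
  let U : Set (Γ → ℕ) := ⋂ γ ∈ domP φ, cyl (place (ψ ((φ.1 γ).getD 0)) γ)
  have hU : IsOpen U := Finite.isOpen_biInter φ.2 fun γ _ => isOpen_cyl _
  let x₀ : Γ → ℕ := fun δ =>
    if h : ∃ c γ m, φ.1 γ = some m ∧ (place (ψ m) γ).1 δ = some c then h.choose else 0
  have hx₀ : x₀ ∈ U := by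
    simp only [U, mem_iInter]
    intro γ hγ δ c hc
    obtain ⟨m, hm⟩ := Option.ne_none_iff_exists'.1 hγ
    simp only [hm, Option.getD_some] at hc
    have h : ∃ c γ m, φ.1 γ = some m ∧ (place (ψ m) γ).1 δ = some c := ⟨c, γ, m, hm, hc⟩
    simp only [x₀, dif_pos h]
    obtain ⟨γ', m', hm', hc'⟩ := h.choose_spec
    exact hφ γ' γ m' m hm' hm δ _ _ hc' hc
  obtain ⟨x, hxU, hxG⟩ := (dense_of_mem_residual hG).inter_open_nonempty U hU ⟨x₀, hx₀⟩
  refine ⟨x, hxG, fun γ m hm => ?_⟩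
  simp only [U, mem_iInter] at hxU
  have := hxU γ (by simp [domP, hm])
  rwa [hm] at this

theorem mem_finOf_patchSubshift [Countable Γ]
    (hG : {x : Γ → ℕ | ∀ γ, ∃ n, x ∈ cyl (place (ψ n) γ)} ∈ residual (Γ → ℕ)) {φ : FPC Γ} :
    φ ∈ FinOf (patchSubshift ψ) ↔
      ∀ γ γ' m n, φ.1 γ = some m → φ.1 γ' = some n → Compatible ψ γ γ' m n := by
  constructor
  · rintro ⟨ω, hω, h⟩ γ γ' m n hm hn
    rw [← h γ m hm, ← h γ' n hn]
    exact hω γ γ'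
  · intro hφ
    obtain ⟨x, hxG, hx⟩ := exists_mem_cyl_of_compatible hφ hG
    choose a ha using hxG
    refine ⟨fun γ => (φ.1 γ).getD (a γ), ?_, fun γ c hc => by simp [hc]⟩
    have key : ∀ γ, x ∈ cyl (place (ψ ((φ.1 γ).getD (a γ))) γ) := by
      intro γ
      cases hγ : φ.1 γ with
      | none => exact ha γ
      | some m => exact hx γ m hγ
    intro γ γ' δ c c' h h'
    exact (key γ δ c h).symm.trans (key γ' δ c' h')

theorem isLocal_patchSubshift [Countable Γ] [MetricSpace Γ]
    (hinv : ∀ γ δ g : Γ, dist (γ * g) (δ * g) = dist γ δ)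
    (hG : {x : Γ → ℕ | ∀ γ, ∃ n, x ∈ cyl (place (ψ n) γ)} ∈ residual (Γ → ℕ)) :
    IsLocal (FinOf (patchSubshift ψ)) := by
  have hr : ∀ n, ∃ r : ℝ, 0 ≤ r ∧ ∀ δ ∈ domP (ψ n), dist 1 δ ≤ r := by
    intro n
    obtain ⟨r, hr⟩ := ((ψ n).2.image (dist 1)).bddAbove
    exact ⟨max r 0, le_max_right _ _, fun δ hδ =>
      (hr (mem_image_of_mem _ hδ)).trans (le_max_left _ _)⟩
  choose r hr0 hr using hr
  have hball : ∀ n γ δ c, (place (ψ n) γ).1 δ = some c → dist γ δ ≤ r n := by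
    intro n γ δ c h
    have h' : (ψ n).1 (δ * γ⁻¹) = some c := h
    have := hr n (δ * γ⁻¹) (by simp [domP, h'])
    rwa [← hinv 1 _ γ, one_mul, inv_mul_cancel_right] at this
  refine ⟨fun n => 2 * r n, fun n => by simpa using hr0 n, ?_⟩
  ext φ
  rw [mem_finOf_patchSubshift hG]
  constructor
  · intro h γ c _
    rw [mem_finOf_patchSubshift hG]
    intro γ₁ γ₂ m n hm hn
    simp only [restrictBall] at hm hn
    split_ifs at hm hn
    exact h γ₁ γ₂ m n hm hn
  · have key : ∀ γ γ' m n, φ ∈ LocallyIn (FinOf (patchSubshift ψ)) (fun n => 2 * r n) →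
        φ.1 γ = some m → φ.1 γ' = some n → r n ≤ r m → Compatible ψ γ γ' m n := by
      intro γ γ' m n h hm hn hle δ c c' hc hc'
      have h1 := h γ m hm
      rw [mem_finOf_patchSubshift hG] at h1
      have hd : dist γ γ' ≤ 2 * r m := by
        have h2 := dist_triangle_right γ γ' δ
        linarith [hball _ _ _ _ hc, hball _ _ _ _ hc']
      refine h1 γ γ' m n ?_ ?_ δ c c' hc hc'
      · simp [restrictBall, hm, hr0]
      · simp [restrictBall, hn, hd]
    intro h γ γ' m n hm hn
    rcases le_total (r n) (r m) with hle | hle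
    · exact key γ γ' m n h hm hn hle
    · exact fun δ c c' hc hc' => (key γ' γ n m h hn hm hle δ c' c hc' hc).symm

end PatchSubshift

theorem ShiftHasBMColoring.exists_isLocal [Group Γ] [Countable Γ] [MetricSpace Γ]
    (hinv : ∀ γ δ g : Γ, dist (γ * g) (δ * g) = dist γ δ)
    {Ω : Set (Γ → ℕ)} (hΩ : IsSubshift Ω) (h : ShiftHasBMColoring Γ Ω) :
    ∃ (Ω' : Set (Γ → ℕ)) (ρ : ℕ → ℕ), IsSubshift Ω' ∧ IsLocal (FinOf Ω') ∧
      ∀ ω ∈ Ω', (fun γ : Γ => ρ (ω γ)) ∈ Ω := by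
  classical
  obtain ⟨f, hf, hfΩ⟩ := h
  let Q := {a : FPC Γ × ℕ // IsMeagre (cyl a.1 \ f ⁻¹' {a.2})}
  choose O hO hOm using fun c : ℕ => hf {c} (measurableSet_singleton c)
  have hgen : {x | ∃ a : Q, x ∈ cyl a.1.1} ∈ residual (Γ → ℕ) := by
    refine Filter.mem_of_superset (countable_iInter_mem.2 hOm) fun x hx => ?_
    simp only [mem_iInter, mem_compl_iff, mem_symmDiff, not_or, not_and, not_not] at hx
    obtain ⟨S, hS⟩ := exists_finset_cylinder (hO (f x)) ((hx (f x)).1 rfl)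
    have hsub : cyl (restrictTo x S) ⊆ O (f x) := fun y hy => hS y fun γ hγ =>
      hy γ (x γ) (by simp [restrictTo, hγ])
    refine ⟨⟨(restrictTo x S, f x), (hOm (f x)).mono ?_⟩, ?_⟩
    · exact fun y hy => Or.inr ⟨hsub hy.1, hy.2⟩
    · intro γ c hc
      simp only [restrictTo] at hc
      split_ifs at hc
      exact Option.some.inj hc
  have : Nonempty Q := by
    obtain ⟨x, a, -⟩ := (dense_of_mem_residual hgen).nonempty
    exact ⟨a⟩
  obtain ⟨e, he⟩ := exists_surjective_nat Q
  let ψ : ℕ → FPC Γ := fun n => (e n).1.1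
  let ρ : ℕ → ℕ := fun n => (e n).1.2
  have hG : {x : Γ → ℕ | ∀ γ, ∃ n, x ∈ cyl (place (ψ n) γ)} ∈ residual (Γ → ℕ) := by
    refine Filter.mem_of_superset
      (countable_iInter_mem.2 fun γ : Γ => shift_preimage_mem_residual γ hgen) fun x hx γ => ?_
    obtain ⟨a, ha⟩ := mem_iInter.1 hx γ
    obtain ⟨n, rfl⟩ := he a
    exact ⟨n, mem_cyl_place.2 ha⟩
  refine ⟨patchSubshift ψ, ρ, isSubshift_patchSubshift, isLocal_patchSubshift hinv hG, ?_⟩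
  intro ω hω
  have hval : {x | ∀ γ n, x ∈ cyl (place (ψ n) γ) → f (shift γ x) = ρ n} ∈
      residual (Γ → ℕ) := by
    refine Filter.mem_of_superset (countable_iInter_mem.2 fun γ : Γ =>
      countable_iInter_mem.2 fun n => shift_preimage_mem_residual γ (e n).2) fun x hx γ n h => ?_
    by_contra hne
    exact mem_iInter.1 (mem_iInter.1 hx γ) n ⟨mem_cyl_place.1 h, hne⟩
  refine mem_of_forall_finset hΩ.1 fun S => ?_
  obtain ⟨x, ⟨hx1, hx2⟩, hx⟩ := exists_mem_cyl_of_compatible (ψ := ψ)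
    ((mem_finOf_patchSubshift hG).1 (finOf_restrict hω S)) (Filter.inter_mem hfΩ hval)
  exact ⟨_, hx1, fun γ hγ => hx2 γ _ (hx γ (ω γ) (by simp [restrictTo, hγ]))⟩

theorem mapP_joinP (ρ : ℕ → ℕ) (φ ψ : FPC Γ) :
    mapP ρ (joinP φ ψ) = joinP (mapP ρ φ) (mapP ρ ψ) := by
  apply Subtype.ext
  funext δ
  cases h : φ.1 δ <;> simp [mapP, joinP, h]

theorem mapP_joinList (ρ : ℕ → ℕ) (l : List (FPC Γ)) :
    mapP ρ (joinList l) = joinList (l.map (mapP ρ)) := by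
  induction l with
  | nil => rfl
  | cons φ l ih =>
    change mapP ρ (joinP φ (joinList l)) = joinP (mapP ρ φ) (joinList (l.map (mapP ρ)))
    rw [mapP_joinP, ih]

theorem domP_mapP (ρ : ℕ → ℕ) (φ : FPC Γ) : domP (mapP ρ φ) = domP φ := by
  ext δ
  simp [domP, mapP]

theorem finOf_closure_image (ρ : ℕ → ℕ) (Ω : Set (Γ → ℕ)) :
    FinOf (closure ((fun ω γ => ρ (ω γ)) '' Ω)) = mapP ρ '' FinOf Ω := by
  classical
  ext φ
  constructor
  · rintro ⟨ω, hω, h⟩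
    obtain ⟨_, hxφ, ω', hω', rfl⟩ := mem_closure_iff.1 hω (cyl φ) (isOpen_cyl φ) h
    refine ⟨restrictTo ω' φ.2.toFinset, finOf_restrict hω' _, Subtype.ext (funext fun δ => ?_)⟩
    cases hδ : φ.1 δ with
    | none => simp [mapP, restrictTo, hδ]
    | some c => simp [mapP, restrictTo, hδ, hxφ δ c hδ]
  · rintro ⟨ψ, ⟨ω, hω, h⟩, rfl⟩
    refine ⟨_, subset_closure (mem_image_of_mem _ hω), fun γ c hc => ?_⟩
    obtain ⟨a, ha, rfl⟩ := Option.map_eq_some_iff.1 hc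
    rw [h γ a ha]

theorem isSubshift_closure_image [Group Γ] (ρ : ℕ → ℕ) {Ω : Set (Γ → ℕ)} (hΩ : IsSubshift Ω) :
    IsSubshift (closure ((fun ω γ => ρ (ω γ)) '' Ω)) := by
  refine ⟨isClosed_closure, fun γ ω hω => map_mem_closure (continuous_shift γ) hω ?_⟩
  rintro _ ⟨ω', hω', rfl⟩
  exact ⟨shift γ ω', hΩ.2 γ ω' hω', rfl⟩

theorem IsLocal.hasJoinProperty_closure_image [Group Γ] [MetricSpace Γ] (ρ : ℕ → ℕ)
    {Ω : Set (Γ → ℕ)} (hΩ : IsSubshift Ω) (h : IsLocal (FinOf Ω)) :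
    HasJoinProperty (FinOf (closure ((fun ω γ => ρ (ω γ)) '' Ω))) := by
  obtain ⟨r, -, hr⟩ := h
  let A : FPC Γ → Set ℕ := fun φ =>
    {n | ∃ ψ ∈ FinOf Ω, mapP ρ ψ = φ ∧ ∀ γ c, ψ.1 γ = some c → r c ≤ n}
  have hA : ∀ φ ∈ mapP ρ '' FinOf Ω, (A φ).Nonempty := by
    rintro _ ⟨ψ, hψ, rfl⟩
    obtain ⟨K, hK⟩ := (ψ.2.image fun γ => r ((ψ.1 γ).getD 0)).bddAbove
    obtain ⟨n, hn⟩ := exists_nat_ge K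
    refine ⟨n, ψ, hψ, rfl, fun γ c hc => le_trans ?_ hn⟩
    exact hK ⟨γ, by simp [hc], by simp [hc]⟩
  have hAshift : ∀ γ φ, A φ ⊆ A (shiftP γ φ) := by
    rintro γ _ n ⟨ψ, hψ, rfl, hn⟩
    exact ⟨shiftP γ ψ, shiftP_mem_finOf hΩ γ hψ, rfl, fun δ c hc => hn _ c hc⟩
  rw [finOf_closure_image]
  refine ⟨fun φ => (sInf (A φ) : ℕ), fun φ => Nat.cast_nonneg _, fun γ φ _ => ?_, ?_⟩
  · have hback : shiftP γ⁻¹ (shiftP γ φ) = φ :=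
      Subtype.ext (funext fun δ => by simp [shiftP])
    have : A (shiftP γ φ) = A φ := by
      refine Subset.antisymm ?_ (hAshift γ φ)
      conv_rhs => rw [← hback]
      exact hAshift γ⁻¹ (shiftP γ φ)
    simp only [this]
  · intro l hl hsep
    choose! F hFΩ hFφ hFr using fun φ (hφ : φ ∈ mapP ρ '' FinOf Ω) => Nat.sInf_mem (hA φ hφ)
    have hmap : (l.map F).map (mapP ρ) = l := by
      rw [List.map_map]
      conv_rhs => rw [← List.map_id l]
      exact List.map_congr_left fun φ hφ => hFφ φ (hl φ hφ)
    have hdom : ∀ φ ∈ l, ∀ γ c, (F φ).1 γ = some c → γ ∈ domP φ := by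
      intro φ hφ γ c hc
      rw [← hFφ φ (hl φ hφ), domP_mapP]
      simp [domP, hc]
    have hsep' : (l.map F).Pairwise (RSeparated fun _ => 0) := by
      rw [List.pairwise_map]
      refine hsep.imp_of_mem fun {φ φ'} hφ hφ' h γ hγ δ hδ => ?_
      obtain ⟨c, hc⟩ := Option.ne_none_iff_exists'.1 hγ
      obtain ⟨c', hc'⟩ := Option.ne_none_iff_exists'.1 hδ
      refine lt_of_le_of_lt ?_ (h γ (hdom φ hφ γ c hc) δ (hdom φ' hφ' δ c' hc'))
      rw [add_zero]
      positivity
    refine ⟨joinList (l.map F), ?_, by rw [mapP_joinList, hmap]⟩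
    rw [hr]
    intro γ c hc
    obtain ⟨_, hmem, hφc⟩ := exists_mem_of_joinList hc
    obtain ⟨φ, hφ, rfl⟩ := List.mem_map.1 hmem
    have hloc := hFΩ φ (hl φ hφ)
    rw [hr] at hloc
    convert hloc γ c hφc using 1
    refine Subtype.ext (funext fun δ => ?_)
    by_cases hd : dist γ δ ≤ r c
    · simp only [restrictBall, if_pos hd]
      cases hδ : (F φ).1 δ with
      | some a => exact joinList_apply_of_mem (fun _ => le_rfl) hsep' hmem hδ
      | none =>
        by_contra hne
        obtain ⟨a, ha⟩ := Option.ne_none_iff_exists'.1 hne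
        obtain ⟨_, hmem', hφ'a⟩ := exists_mem_of_joinList ha
        obtain ⟨φ', hφ', rfl⟩ := List.mem_map.1 hmem'
        have hφφ' : φ ≠ φ' := by
          rintro rfl
          simp [hδ] at hφ'a
        have : Std.Symm (RSeparated fun φ : FPC Γ => ((sInf (A φ) : ℕ) : ℝ)) :=
          ⟨fun _ _ h => h.symm⟩
        have hs := hsep.forall hφ hφ' hφφ' γ (hdom φ hφ γ c hφc) δ
          (hdom φ' hφ' δ a hφ'a)
        have h1 := hFr φ (hl φ hφ) γ c hφc
        have h2 : (0 : ℝ) ≤ (sInf (A φ') : ℕ) := Nat.cast_nonneg _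
        linarith
    · simp only [restrictBall, if_neg hd]

/-- Combinatorial characterization: a subshift `Ω` admits a Baire measurable coloring of
the shift action iff it contains a subshift with the join property iff it is reducible
to a local subshift. -/
theorem stmt13 {Γ : Type*} [Group Γ] [Countable Γ] [Infinite Γ] [MetricSpace Γ]
    (hinv : ∀ γ δ g : Γ, dist (γ * g) (δ * g) = dist γ δ)
    (hproper : ∀ (γ : Γ) (r : ℝ), (Metric.closedBall γ r).Finite)
    (Ω : Set (Γ → ℕ)) (hΩ : IsSubshift Ω) :
    (ShiftHasBMColoring Γ Ω ↔
      ∃ Ω' : Set (Γ → ℕ), Ω' ⊆ Ω ∧ IsSubshift Ω' ∧ HasJoinProperty (FinOf Ω')) ∧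
    (ShiftHasBMColoring Γ Ω ↔
      ∃ (Ω' : Set (Γ → ℕ)) (ρ : ℕ → ℕ), IsSubshift Ω' ∧ IsLocal (FinOf Ω') ∧
        ∀ ω ∈ Ω', (fun γ : Γ => ρ (ω γ)) ∈ Ω) := by
  have h13 := fun h : ShiftHasBMColoring Γ Ω => h.exists_isLocal hinv hΩ
  have h32 : (∃ (Ω' : Set (Γ → ℕ)) (ρ : ℕ → ℕ), IsSubshift Ω' ∧ IsLocal (FinOf Ω') ∧
      ∀ ω ∈ Ω', (fun γ : Γ => ρ (ω γ)) ∈ Ω) →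
      ∃ Ω' : Set (Γ → ℕ), Ω' ⊆ Ω ∧ IsSubshift Ω' ∧ HasJoinProperty (FinOf Ω') := by
    rintro ⟨Ω', ρ, hΩ', hloc, hρ⟩
    exact ⟨_, closure_minimal (image_subset_iff.2 hρ) hΩ.1, isSubshift_closure_image ρ hΩ',
      hloc.hasJoinProperty_closure_image ρ hΩ'⟩
  have h21 : (∃ Ω' : Set (Γ → ℕ), Ω' ⊆ Ω ∧ IsSubshift Ω' ∧ HasJoinProperty (FinOf Ω')) →
      ShiftHasBMColoring Γ Ω := by
    rintro ⟨Ω', hsub, hΩ', hjoin⟩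
    obtain ⟨f, hf, hfΩ⟩ := hjoin.shiftHasBMColoring hinv hproper hΩ'
    exact ⟨f, hf, Filter.mem_of_superset hfΩ fun _ hx => hsub hx⟩
  exact ⟨⟨fun h => h32 (h13 h), h21⟩, ⟨h13, fun h => h21 (h32 h)⟩⟩

end DescColor
end
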